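/- arXiv:1405.6419 — 3 statements merged into one kernel-verified Lean document; each statement's English description precedes it below -/
import Mathlib

section
/- Let A = kQ/I be a finite dimensional gentle algebra over an algebraically closed field k. Then the maximal paths in the bound quiver (Q,I) form a k-basis of the socle of A regarded as a module over its enveloping algebra A^e = A ⊗_k A^{op}. -/
set_option maxHeartbeats 1000000

noncomputable section

open scoped BigOperators

/-! ## Finite quivers -/

/-- A finite quiver: finite sets of vertices and arrows, with source and target maps. -/
structure FinQuiver where
  V : Type
  A : Type
  [fintypeV : Fintype V]
  [decEqV : DecidableEq V]
  [fintypeA : Fintype A]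
  [decEqA : DecidableEq A]
  src : A → V
  tgt : A → V

attribute [instance] FinQuiver.fintypeV FinQuiver.decEqV FinQuiver.fintypeA FinQuiver.decEqA

namespace FinQuiver

variable (Q : FinQuiver)

/-- A (nontrivial) path in the quiver: a nonempty composable list of arrows. -/
def IsPath (l : List Q.A) : Prop := l ≠ [] ∧ l.Chain' (fun a b => Q.tgt a = Q.src b)

/-- The path `l` starts at the vertex `i`. -/
def StartsAt (l : List Q.A) (i : Q.V) : Prop := ∃ a, l.head? = some a ∧ Q.src a = i

/-- The path `l` ends at the vertex `i`. -/
def EndsAt (l : List Q.A) (i : Q.V) : Prop := ∃ a, l.getLast? = some a ∧ Q.tgt a = i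

/-- The vertex visited at position `d` (`0 ≤ d ≤ l.length`) along the path `l`. -/
def vertexAt (l : List Q.A) (d : ℕ) : Option Q.V :=
  if h : d < l.length then some (Q.src (l.get ⟨d, h⟩))
  else if d = l.length then l.getLast?.map Q.tgt
  else none

/-- The quiver is connected (as an undirected graph). -/
def Connected : Prop := ∀ i j : Q.V,
  Relation.ReflTransGen
    (fun x y => ∃ a : Q.A, (Q.src a = x ∧ Q.tgt a = y) ∨ (Q.src a = y ∧ Q.tgt a = x)) i j

end FinQuiver

/-! ## The path algebra of a finite quiver, presented as a quotient of a free algebra -/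

section PathAlgebra

variable (k : Type) [Field k] (Q : FinQuiver)

/-- The defining relations of the path algebra `kQ` inside the free algebra on the
vertices (trivial paths) and arrows of `Q`. -/
def pathAlgRel : FreeAlgebra k (Q.V ⊕ Q.A) → FreeAlgebra k (Q.V ⊕ Q.A) → Prop := fun x y =>
  y = 0 ∧
    ((∃ i j : Q.V, i ≠ j ∧ x = FreeAlgebra.ι k (Sum.inl i) * FreeAlgebra.ι k (Sum.inl j)) ∨
     (∃ i : Q.V,
        x = FreeAlgebra.ι k (Sum.inl i) * FreeAlgebra.ι k (Sum.inl i) - FreeAlgebra.ι k (Sum.inl i)) ∨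
     (x = (∑ i : Q.V, FreeAlgebra.ι k (Sum.inl i)) - 1) ∨
     (∃ a : Q.A,
        x = FreeAlgebra.ι k (Sum.inl (Q.src a)) * FreeAlgebra.ι k (Sum.inr a) -
          FreeAlgebra.ι k (Sum.inr a)) ∨
     (∃ a : Q.A,
        x = FreeAlgebra.ι k (Sum.inr a) * FreeAlgebra.ι k (Sum.inl (Q.tgt a)) -
          FreeAlgebra.ι k (Sum.inr a)))

/-- The path algebra `kQ` of the finite quiver `Q`. -/
def PathAlg : Type := RingQuot (pathAlgRel k Q)

instance : Ring (PathAlg k Q) := inferInstanceAs (Ring (RingQuot (pathAlgRel k Q)))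

instance : Algebra k (PathAlg k Q) := inferInstanceAs (Algebra k (RingQuot (pathAlgRel k Q)))

/-- The trivial path (primitive idempotent) at the vertex `i`, as an element of `kQ`. -/
def paIdem (i : Q.V) : PathAlg k Q :=
  RingQuot.mkAlgHom k (pathAlgRel k Q) (FreeAlgebra.ι k (Sum.inl i))

/-- The arrow `a`, as an element of `kQ`. -/
def paArrow (a : Q.A) : PathAlg k Q :=
  RingQuot.mkAlgHom k (pathAlgRel k Q) (FreeAlgebra.ι k (Sum.inr a))

/-- The element of `kQ` given by a list of arrows (the product of the arrows);
for a composable list this is the corresponding path, the empty list gives `1`. -/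
def paPath (l : List Q.A) : PathAlg k Q := (l.map (paArrow k Q)).prod

lemma paIdem_mul_paIdem_ne {i j : Q.V} (h : i ≠ j) : paIdem k Q i * paIdem k Q j = 0 := by
  have h0 := RingQuot.mkAlgHom_rel k
    (show pathAlgRel k Q (FreeAlgebra.ι k (Sum.inl i) * FreeAlgebra.ι k (Sum.inl j)) 0 from
      ⟨rfl, Or.inl ⟨i, j, h, rfl⟩⟩)
  rw [map_mul, map_zero] at h0
  exact h0

lemma paIdem_mul_self (i : Q.V) : paIdem k Q i * paIdem k Q i = paIdem k Q i := by
  have h0 := RingQuot.mkAlgHom_rel k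
    (show pathAlgRel k Q
        (FreeAlgebra.ι k (Sum.inl i) * FreeAlgebra.ι k (Sum.inl i) - FreeAlgebra.ι k (Sum.inl i)) 0
      from ⟨rfl, Or.inr (Or.inl ⟨i, rfl⟩)⟩)
  rw [map_sub, map_mul, map_zero, sub_eq_zero] at h0
  exact h0

lemma paIdem_sum : (∑ i : Q.V, paIdem k Q i) = 1 := by
  have h0 := RingQuot.mkAlgHom_rel k
    (show pathAlgRel k Q ((∑ i : Q.V, FreeAlgebra.ι k (Sum.inl i)) - 1) 0 from
      ⟨rfl, Or.inr (Or.inr (Or.inl rfl))⟩)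
  rw [map_sub, map_sum, map_one, map_zero, sub_eq_zero] at h0
  exact h0

lemma paIdem_src_mul (a : Q.A) : paIdem k Q (Q.src a) * paArrow k Q a = paArrow k Q a := by
  have h0 := RingQuot.mkAlgHom_rel k
    (show pathAlgRel k Q
        (FreeAlgebra.ι k (Sum.inl (Q.src a)) * FreeAlgebra.ι k (Sum.inr a) -
          FreeAlgebra.ι k (Sum.inr a)) 0
      from ⟨rfl, Or.inr (Or.inr (Or.inr (Or.inl ⟨a, rfl⟩)))⟩)
  rw [map_sub, map_mul, map_zero, sub_eq_zero] at h0
  exact h0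

lemma paArrow_mul_tgt (a : Q.A) : paArrow k Q a * paIdem k Q (Q.tgt a) = paArrow k Q a := by
  have h0 := RingQuot.mkAlgHom_rel k
    (show pathAlgRel k Q
        (FreeAlgebra.ι k (Sum.inr a) * FreeAlgebra.ι k (Sum.inl (Q.tgt a)) -
          FreeAlgebra.ι k (Sum.inr a)) 0
      from ⟨rfl, Or.inr (Or.inr (Or.inr (Or.inr ⟨a, rfl⟩)))⟩)
  rw [map_sub, map_mul, map_zero, sub_eq_zero] at h0
  exact h0

/-! ## Bound quiver algebras `kQ/I`, for a set `ρ` of generating relations -/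

/-- Quotienting `kQ` by the two-sided ideal generated by the set `ρ` of relations. -/
def bqaRel (ρ : Set (PathAlg k Q)) : PathAlg k Q → PathAlg k Q → Prop := fun x y => x ∈ ρ ∧ y = 0

/-- The bound quiver algebra `kQ/I`, where `I` is the two-sided ideal of `kQ`
generated by the set of relations `ρ`. -/
def BQA (ρ : Set (PathAlg k Q)) : Type := RingQuot (bqaRel k Q ρ)

instance (ρ : Set (PathAlg k Q)) : Ring (BQA k Q ρ) :=
  inferInstanceAs (Ring (RingQuot (bqaRel k Q ρ)))

instance (ρ : Set (PathAlg k Q)) : Algebra k (BQA k Q ρ) :=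
  inferInstanceAs (Algebra k (RingQuot (bqaRel k Q ρ)))

/-- The canonical projection `kQ → kQ/I`.  An element `x` of `kQ` lies in the ideal `I`
generated by `ρ` if and only if `bq k Q ρ x = 0`. -/
def bq (ρ : Set (PathAlg k Q)) : PathAlg k Q →ₐ[k] BQA k Q ρ :=
  RingQuot.mkAlgHom k (bqaRel k Q ρ)

/-- A maximal (nontrivial) path in the bound quiver `(Q, I)`:  a path avoiding `I` which
becomes zero whenever it is extended by an arrow on either side. -/
def IsMaximalPath (ρ : Set (PathAlg k Q)) (l : List Q.A) : Prop :=
  Q.IsPath l ∧ bq k Q ρ (paPath k Q l) ≠ 0 ∧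
    ∀ a : Q.A, bq k Q ρ (paArrow k Q a * paPath k Q l) = 0 ∧
      bq k Q ρ (paPath k Q l * paArrow k Q a) = 0

/-- A generalized path: either a trivial path at a vertex, or a nontrivial path. -/
def QGPath : Type := Q.V ⊕ {l : List Q.A // Q.IsPath l}

/-- The element of `kQ` corresponding to a generalized path. -/
def paG : QGPath Q → PathAlg k Q := Sum.elim (fun i => paIdem k Q i) (fun l => paPath k Q l.1)

/-- A maximal generalized path (possibly trivial) in `(Q, I)`. -/
def IsMaxGPath (ρ : Set (PathAlg k Q)) (p : QGPath Q) : Prop :=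
  bq k Q ρ (paG k Q p) ≠ 0 ∧
    ∀ a : Q.A, bq k Q ρ (paArrow k Q a * paG k Q p) = 0 ∧
      bq k Q ρ (paG k Q p * paArrow k Q a) = 0

/-- (S1): every vertex is the source of at most two arrows and the target of at most
two arrows. -/
def CondS1 : Prop := ∀ i : Q.V,
  Nat.card {a : Q.A // Q.src a = i} ≤ 2 ∧ Nat.card {a : Q.A // Q.tgt a = i} ≤ 2

/-- (S2): for every arrow `a` there is at most one arrow `b` with `ab ∉ I` and at most
one arrow `c` with `ca ∉ I`. -/
def CondS2 (ρ : Set (PathAlg k Q)) : Prop := ∀ a b c : Q.A,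
  (bq k Q ρ (paArrow k Q a * paArrow k Q b) ≠ 0 →
    bq k Q ρ (paArrow k Q a * paArrow k Q c) ≠ 0 → b = c) ∧
  (bq k Q ρ (paArrow k Q b * paArrow k Q a) ≠ 0 →
    bq k Q ρ (paArrow k Q c * paArrow k Q a) ≠ 0 → b = c)

/-- (S3): the ideal `I` is generated by paths of length `2` (i.e. the generating
set `ρ` consists of paths of length two). -/
def CondS3 (ρ : Set (PathAlg k Q)) : Prop :=
  ∀ x ∈ ρ, ∃ a b : Q.A, Q.tgt a = Q.src b ∧ x = paArrow k Q a * paArrow k Q b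

/-- (S4): for every arrow `a` there is at most one arrow `b` with `ab ∈ I` and at most
one arrow `c` with `ca ∈ I`. -/
def CondS4 (ρ : Set (PathAlg k Q)) : Prop := ∀ a b c : Q.A,
  (Q.tgt a = Q.src b → Q.tgt a = Q.src c →
    bq k Q ρ (paArrow k Q a * paArrow k Q b) = 0 →
    bq k Q ρ (paArrow k Q a * paArrow k Q c) = 0 → b = c) ∧
  (Q.tgt b = Q.src a → Q.tgt c = Q.src a →
    bq k Q ρ (paArrow k Q b * paArrow k Q a) = 0 →
    bq k Q ρ (paArrow k Q c * paArrow k Q a) = 0 → b = c)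

/-- A special biserial presentation `(Q, ρ)`. -/
def IsSpecialBiserialPres (ρ : Set (PathAlg k Q)) : Prop := CondS1 Q ∧ CondS2 k Q ρ

/-- A gentle presentation `(Q, ρ)`. -/
def IsGentlePres (ρ : Set (PathAlg k Q)) : Prop :=
  CondS1 Q ∧ CondS2 k Q ρ ∧ CondS3 k Q ρ ∧ CondS4 k Q ρ

/-- The ideal generated by `ρ` is admissible: it contains all sufficiently long paths
and is contained in the ideal generated by the paths of length two. -/
def IsAdmissibleRels (ρ : Set (PathAlg k Q)) : Prop :=
  (∃ n : ℕ, ∀ l : List Q.A, n ≤ l.length → bq k Q ρ (paPath k Q l) = 0) ∧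
  ∀ x ∈ ρ, x ∈ Submodule.span k
    {y : PathAlg k Q | ∃ l : List Q.A, Q.IsPath l ∧ 2 ≤ l.length ∧ y = paPath k Q l}

end PathAlgebra

/-- A finite dimensional algebra `B` is symmetric if `B ≅ D(B)` as `B`-`B`-bimodules,
where `D(B) = Hom_k(B,k)`; the bimodule structure on `D(B)` is
`(a • f • b)(y) = f (b * y * a)`. -/
def IsSymmetricAlg (k : Type) [Field k] (B : Type) [Ring B] [Algebra k B] : Prop :=
  ∃ φ : B ≃ₗ[k] (B →ₗ[k] k), ∀ a x b y : B, φ (a * x * b) y = φ x (b * y * a)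

/-- `B` is a (basic) gentle algebra: it is isomorphic to a finite dimensional bound
quiver algebra `kQ/I` with admissible ideal `I` satisfying (S1)--(S4). -/
def IsGentleAlgebra (k : Type) [Field k] (B : Type) [Ring B] [Algebra k B] : Prop :=
  ∃ (Q : FinQuiver) (ρ : Set (PathAlg k Q)), IsGentlePres k Q ρ ∧ IsAdmissibleRels k Q ρ ∧
    FiniteDimensional k (BQA k Q ρ) ∧ Nonempty (BQA k Q ρ ≃ₐ[k] B)

/-! ## Some list utilities: powers of cyclic paths -/

/-- `m`-fold concatenation of the list `l`. -/
def listPow {α : Type} (l : List α) (m : ℕ) : List α := (List.replicate m l).flatten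

/-- The list `l` is a proper power of a shorter list. -/
def IsProperPower {α : Type} (l : List α) : Prop :=
  ∃ (l₀ : List α) (m : ℕ), 2 ≤ m ∧ l = listPow l₀ m

/-- The multiplicity `e(l)` of a cyclic path `l`: the largest `m` such that `l = l₀^m`
for a (nonempty) cycle `l₀`. -/
def multOf {α : Type} (l : List α) : ℕ :=
  @Nat.findGreatest (fun m => ∃ l₀ : List α, l₀ ≠ [] ∧ l = listPow l₀ m)
    (Classical.decPred _) l.length

/-! ## The trivial extension `T(A) = A ⋉ D(A)` -/

/-- The trivial extension of the `k`-algebra `A` by its dual `D(A) = Hom_k(A,k)`: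
the underlying vector space is `A ⊕ D(A)`, with multiplication
`(a,f)(b,g) = (ab, a•g + f•b)`, where `(a•g)(y) = g(y*a)` and `(f•b)(y) = f(b*y)`. -/
def TrivExt (k : Type) [Field k] (A : Type) [Ring A] [Algebra k A] : Type :=
  A × (A →ₗ[k] k)

namespace TrivExt

variable {k : Type} [Field k] {A : Type} [Ring A] [Algebra k A]

instance : AddCommGroup (TrivExt k A) := inferInstanceAs (AddCommGroup (A × (A →ₗ[k] k)))

instance : Module k (TrivExt k A) := inferInstanceAs (Module k (A × (A →ₗ[k] k)))

/-- First component. -/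
def fst (x : TrivExt k A) : A := x.1

/-- Second component. -/
def snd (x : TrivExt k A) : A →ₗ[k] k := x.2

/-- Building an element of the trivial extension from its two components. -/
def mk' (a : A) (f : A →ₗ[k] k) : TrivExt k A := (a, f)

instance : Mul (TrivExt k A) :=
  ⟨fun x y => (x.1 * y.1, y.2.comp (LinearMap.mulRight k x.1) + x.2.comp (LinearMap.mulLeft k y.1))⟩

instance : One (TrivExt k A) := ⟨((1 : A), 0)⟩

lemma mul_fst' (x y : TrivExt k A) : (x * y).1 = x.1 * y.1 := rfl

lemma mul_snd' (x y : TrivExt k A) :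
    (x * y).2 = y.2.comp (LinearMap.mulRight k x.1) + x.2.comp (LinearMap.mulLeft k y.1) := rfl

lemma one_fst' : (1 : TrivExt k A).1 = (1 : A) := rfl
lemma one_snd' : (1 : TrivExt k A).2 = 0 := rfl
lemma add_fst' (x y : TrivExt k A) : (x + y).1 = x.1 + y.1 := rfl
lemma add_snd' (x y : TrivExt k A) : (x + y).2 = x.2 + y.2 := rfl
lemma zero_fst' : (0 : TrivExt k A).1 = 0 := rfl
lemma zero_snd' : (0 : TrivExt k A).2 = 0 := rfl
lemma smul_fst' (c : k) (x : TrivExt k A) : (c • x).1 = c • x.1 := rfl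
lemma smul_snd' (c : k) (x : TrivExt k A) : (c • x).2 = c • x.2 := rfl

instance instRing : Ring (TrivExt k A) where
  __ := (inferInstance : AddCommGroup (TrivExt k A))
  mul := (· * ·)
  one := 1
  mul_assoc x y z := by
    refine Prod.ext (mul_assoc x.1 y.1 z.1) ?_
    simp only [mul_snd', mul_fst']
    ext w
    simp [mul_assoc]
    abel
  one_mul x := by
    refine Prod.ext (one_mul x.1) ?_
    simp only [mul_snd', one_fst', one_snd']
    ext w
    simp
  mul_one x := by
    refine Prod.ext (mul_one x.1) ?_
    simp only [mul_snd', one_fst', one_snd']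
    ext w
    simp
  left_distrib x y z := by
    refine Prod.ext (mul_add x.1 y.1 z.1) ?_
    simp only [mul_snd', add_snd', add_fst', mul_fst']
    ext w
    simp [mul_add, add_mul]
    abel
  right_distrib x y z := by
    refine Prod.ext (add_mul x.1 y.1 z.1) ?_
    simp only [mul_snd', add_snd', add_fst', mul_fst']
    ext w
    simp [mul_add, add_mul]
    abel
  zero_mul x := by
    refine Prod.ext (zero_mul x.1) ?_
    simp only [mul_snd', zero_fst', zero_snd']
    ext w
    simp
  mul_zero x := by
    refine Prod.ext (mul_zero x.1) ?_
    simp only [mul_snd', zero_fst', zero_snd']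
    ext w
    simp

instance instAlgebra : Algebra k (TrivExt k A) :=
  Algebra.ofModule
    (fun r x y => by
      refine Prod.ext ?_ ?_
      · show (r • x.1) * y.1 = r • (x.1 * y.1)
        exact smul_mul_assoc r x.1 y.1
      · show y.2.comp (LinearMap.mulRight k (r • x.1)) +
            (r • x.2).comp (LinearMap.mulLeft k y.1) =
            r • (y.2.comp (LinearMap.mulRight k x.1) + x.2.comp (LinearMap.mulLeft k y.1))
        ext w
        simp [mul_smul_comm, smul_add])
    (fun r x y => by
      refine Prod.ext ?_ ?_
      · show x.1 * (r • y.1) = r • (x.1 * y.1)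
        exact mul_smul_comm r x.1 y.1
      · show (r • y.2).comp (LinearMap.mulRight k x.1) +
            x.2.comp (LinearMap.mulLeft k (r • y.1)) =
            r • (y.2.comp (LinearMap.mulRight k x.1) + x.2.comp (LinearMap.mulLeft k y.1))
        ext w
        simp [smul_mul_assoc, smul_add])

end TrivExt

/-! ## Brauer graphs (in half-edge / ribbon graph form) and Brauer graph algebras -/

/-- A Brauer graph: a finite connected graph, possibly with loops and multiple edges,
equipped with a cyclic ordering of the edges around each vertex and a positive integer
multiplicity at each vertex.  It is encoded by its finite nonempty set `H` of half-edges,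
the fixed-point-free involution `ε` pairing the two half-edges of each edge, the
permutation `σ` whose orbits are the vertices, with `σ` giving the cyclic ordering of
the half-edges around each vertex, and the multiplicity function `mult` (constant on
vertices, i.e. on `σ`-orbits). -/
structure BrauerGraph where
  H : Type
  [fintypeH : Fintype H]
  [decEqH : DecidableEq H]
  [nonemptyH : Nonempty H]
  σ : Equiv.Perm H
  ε : Equiv.Perm H
  ε_invol : ∀ h, ε (ε h) = h
  ε_ne : ∀ h, ε h ≠ h
  mult : H → ℕ
  mult_pos : ∀ h, 0 < mult h
  mult_sigma : ∀ h, mult (σ h) = mult h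
  conn : ∀ h h' : H, Relation.ReflTransGen (fun x y => y = σ x ∨ y = ε x) h h'

attribute [instance] BrauerGraph.fintypeH BrauerGraph.decEqH BrauerGraph.nonemptyH

namespace BrauerGraph

variable (G : BrauerGraph)

/-- Two half-edges span the same edge of the graph. -/
instance edgeSetoid : Setoid G.H where
  r h h' := h' = h ∨ h' = G.ε h
  iseqv := by
    refine ⟨fun h => Or.inl rfl, ?_, ?_⟩
    · intro a b hab
      rcases hab with h | h
      · subst h; exact Or.inl rfl
      · subst h; exact Or.inr (G.ε_invol a).symm
    · intro a b c hab hbc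
      rcases hab with h | h
      · subst h; exact hbc
      · subst h
        rcases hbc with h' | h'
        · subst h'; exact Or.inr rfl
        · subst h'; exact Or.inl (G.ε_invol a)

instance : DecidableRel (edgeSetoid G).r := fun a b =>
  decidable_of_iff (b = a ∨ b = G.ε a) Iff.rfl

instance : DecidableEq (Quotient (edgeSetoid G)) :=
  @Quotient.decidableEq _ _ (fun a b => decidable_of_iff (b = a ∨ b = G.ε a) Iff.rfl)

instance : Fintype (Quotient (edgeSetoid G)) :=
  @Quotient.fintype _ _ (edgeSetoid G) (fun a b => decidable_of_iff (b = a ∨ b = G.ε a) Iff.rfl)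

/-- The half-edge `h` carries an arrow of the quiver of the Brauer graph (this fails
exactly when the vertex of `h` is a leaf vertex of multiplicity one). -/
def hasArrow (h : G.H) : Prop := G.σ h ≠ h ∨ 1 < G.mult h

instance : DecidablePred G.hasArrow := fun h =>
  inferInstanceAs (Decidable (G.σ h ≠ h ∨ 1 < G.mult h))

lemma hasArrow_sigma {h : G.H} (hh : G.hasArrow h) : G.hasArrow (G.σ h) := by
  rcases hh with h1 | h2
  · exact Or.inl fun e => h1 (G.σ.injective e)
  · exact Or.inr (by rw [G.mult_sigma]; exact h2)

lemma hasArrow_iterate (n : ℕ) {h : G.H} (hh : G.hasArrow h) : G.hasArrow ((⇑G.σ)^[n] h) := by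
  induction n with
  | zero => exact hh
  | succ n ih =>
      rw [Function.iterate_succ_apply']
      exact G.hasArrow_sigma ih

/-- The quiver of a Brauer graph: vertices are the edges of `Γ`, and there is an arrow
from `E` to `E'` whenever `E'` is the direct successor of `E` in the cyclic ordering
around a common vertex (no arrow at a leaf of multiplicity one). -/
def quiver : FinQuiver where
  V := Quotient (edgeSetoid G)
  A := {h : G.H // G.hasArrow h}
  src a := Quotient.mk (edgeSetoid G) a.1
  tgt a := Quotient.mk (edgeSetoid G) (G.σ a.1)

/-- The list of arrows of the cycle of the quiver of `Γ` attached to the vertex of the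
half-edge `h`, starting at the edge of `h`. -/
def cycleArrows (h : G.H) (hh : G.hasArrow h) : List G.quiver.A :=
  (List.range (Function.minimalPeriod (⇑G.σ) h)).map fun n =>
    ⟨(⇑G.σ)^[n] h, G.hasArrow_iterate n hh⟩

end BrauerGraph

section BGA

variable (k : Type) [Field k] (G : BrauerGraph)

/-- The special cycle `C_{ν,i}` of the quiver of `Γ`, attached to the vertex `ν` of the
half-edge `h` and starting at the edge `i` of `h`, as an element of the path algebra. -/
def cycleEl (h : G.H) (hh : G.hasArrow h) : PathAlg k G.quiver :=
  paPath k G.quiver (G.cycleArrows h hh)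

/-- The defining relations of the Brauer graph algebra of `Γ`: (a) for every edge whose
two endpoints both carry cycles, the difference of the corresponding powers of the two
special cycles; (b) for every edge with one endpoint a leaf of multiplicity one, the
power of the special cycle at the other endpoint composed with one more arrow;
(c) all compositions of two arrows lying in cycles attached to distinct vertices. -/
def brauerRels : Set (PathAlg k G.quiver) :=
  {x | ∃ (h : G.H) (hh : G.hasArrow h) (hh' : G.hasArrow (G.ε h)),
      x = cycleEl k G h hh ^ G.mult h - cycleEl k G (G.ε h) hh' ^ G.mult (G.ε h)} ∪
  {x | ∃ (h : G.H) (hh : G.hasArrow h), ¬ G.hasArrow (G.ε h) ∧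
      x = cycleEl k G h hh ^ G.mult h * paArrow k G.quiver ⟨h, hh⟩} ∪
  {x | ∃ a b : G.quiver.A, G.quiver.tgt a = G.quiver.src b ∧ ¬ G.σ.SameCycle a.1 b.1 ∧
      x = paArrow k G.quiver a * paArrow k G.quiver b}

/-- The Brauer graph algebra of the Brauer graph `Γ`. -/
def BrauerGraphAlgebra : Type := BQA k G.quiver (brauerRels k G)

instance : Ring (BrauerGraphAlgebra k G) :=
  inferInstanceAs (Ring (BQA k G.quiver (brauerRels k G)))

instance : Algebra k (BrauerGraphAlgebra k G) :=
  inferInstanceAs (Algebra k (BQA k G.quiver (brauerRels k G)))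

/-- A cutting set: a set of arrows of the quiver of `Γ` containing exactly one arrow
from every vertex cycle. -/
def IsCuttingSet (D : Set G.quiver.A) : Prop :=
  ∀ a : G.quiver.A, ∃! b : G.quiver.A, b ∈ D ∧ G.σ.SameCycle a.1 b.1

/-- The admissible cut of the Brauer graph algebra of `Γ` with respect to the cutting
set `D`: the quotient of `kQ_Γ` by the ideal generated by the Brauer relations together
with the arrows in `D`. -/
def CutAlgebra (D : Set G.quiver.A) : Type :=
  BQA k G.quiver (brauerRels k G ∪ (paArrow k G.quiver '' D))

instance (D : Set G.quiver.A) : Ring (CutAlgebra k G D) :=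
  inferInstanceAs (Ring (BQA k G.quiver (brauerRels k G ∪ (paArrow k G.quiver '' D))))

instance (D : Set G.quiver.A) : Algebra k (CutAlgebra k G D) :=
  inferInstanceAs (Algebra k (BQA k G.quiver (brauerRels k G ∪ (paArrow k G.quiver '' D))))

end BGA

/-- The quiver obtained from the quiver of the Brauer graph `Γ` by deleting the arrows
of the cutting set `D`. -/
def cutQuiver (G : BrauerGraph) (D : Set G.quiver.A) : FinQuiver where
  V := G.quiver.V
  A := {a : G.quiver.A // a ∉ D}
  fintypeA := @Subtype.fintype _ _ (fun _ => Classical.propDecidable _) _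
  src a := G.quiver.src a.1
  tgt a := G.quiver.tgt a.1

/-- Isomorphism of Brauer graphs: a bijection of half-edges commuting with the cyclic
orderings and the edge pairings, and preserving multiplicities. -/
def BrauerGraphIso (G G' : BrauerGraph) : Prop :=
  ∃ ψ : G.H ≃ G'.H, (∀ h, ψ (G.σ h) = G'.σ (ψ h)) ∧ (∀ h, ψ (G.ε h) = G'.ε (ψ h)) ∧
    (∀ h, G'.mult (ψ h) = G.mult h)

/-! ## The graph (with local structure) of a symmetric special biserial algebra,
and the graph of a gentle algebra -/

section GraphOf

variable (k : Type) [Field k] (Q : FinQuiver) (ρ : Set (PathAlg k Q))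

/-- The projective indecomposable at `i` is uniserial (at most one arrow out of `i`
survives in `kQ/I`); in this case the trivial path at `i` counts as a maximal cyclic
path in the construction of the graph of a symmetric special biserial algebra. -/
def UniserialAt (i : Q.V) : Prop :=
  Set.Subsingleton {a : Q.A | Q.src a = i ∧ bq k Q ρ (paArrow k Q a) ≠ 0}

/-- Pointed maximal cyclic paths of `kQ/I` (the germs of edges of the graph `G_Λ`):
either a maximal cyclic path starting at a given vertex (a rotation representative),
or a trivial path at a vertex with uniserial projective. -/
def SHalf : Type :=
  {l : List Q.A // IsMaximalPath k Q ρ l ∧ ∃ i : Q.V, Q.StartsAt l i ∧ Q.EndsAt l i} ⊕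
  {i : Q.V // UniserialAt k Q ρ i}

/-- The vertex of `Q` (= edge of `G_Λ`) labelling a germ. -/
def sLabel : SHalf k Q ρ → Option Q.V :=
  Sum.elim (fun l => l.1.head?.map Q.src) (fun i => some i.1)

/-- Rotating a pointed maximal cyclic path by one step (the cyclic ordering of the
germs around a vertex of `G_Λ`). -/
def sRotRel : SHalf k Q ρ → SHalf k Q ρ → Prop := fun x y =>
  match x, y with
  | Sum.inl l, Sum.inl l' => l'.1 = l.1.rotate 1
  | Sum.inr i, Sum.inr i' => i.1 = i'.1
  | _, _ => False

/-- The multiplicity of the vertex of `G_Λ` corresponding to a germ. -/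
def sMult : SHalf k Q ρ → ℕ := Sum.elim (fun l => multOf l.1) (fun _ => 1)

/-- `G` is (isomorphic to) the graph with local structure `G_Λ` of the symmetric special
biserial algebra `Λ = kQ/I`:  the half-edges of `G` correspond to the pointed maximal
cyclic paths, the cyclic ordering `σ` to the rotation of pointed paths, the edge pairing
`ε` matches the two germs labelled by the same vertex of `Q`, and the multiplicities are
the multiplicities `e(p)` of the maximal cyclic paths. -/
def IsGraphOfSSB (G : BrauerGraph) : Prop :=
  ∃ φ : G.H ≃ SHalf k Q ρ,
    (∀ h, sRotRel k Q ρ (φ h) (φ (G.σ h))) ∧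
    (∀ h, sLabel k Q ρ (φ (G.ε h)) = sLabel k Q ρ (φ h)) ∧
    (∀ h, G.mult h = sMult k Q ρ (φ h))

/-- The trivial path at `i` belongs to the extended set of maximal paths of a gentle
algebra: `i` is a sink with a single incoming arrow, a source with a single outgoing
arrow, or has a single incoming arrow `α` and a single outgoing arrow `β` with `αβ ∉ I`. -/
def ExtTriv (i : Q.V) : Prop :=
  ((∀ a : Q.A, Q.src a ≠ i) ∧ (∃! a : Q.A, Q.tgt a = i)) ∨
  ((∀ a : Q.A, Q.tgt a ≠ i) ∧ (∃! a : Q.A, Q.src a = i)) ∨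
  (∃ α β : Q.A, (∀ a : Q.A, Q.tgt a = i ↔ a = α) ∧ (∀ b : Q.A, Q.src b = i ↔ b = β) ∧
    bq k Q ρ (paArrow k Q α * paArrow k Q β) ≠ 0)

/-- The half-edges of the graph `Γ_A` of a gentle algebra `A = kQ/I`: occurrences of
vertices of `Q` along the (extended set of) maximal paths. -/
def GHalf : Type :=
  (Σ m : {l : List Q.A // IsMaximalPath k Q ρ l}, Fin (m.1.length + 1)) ⊕
  {i : Q.V // ExtTriv k Q ρ i}

/-- The cyclic successor of an occurrence: the next vertex along the maximal path,
the linear order being completed to a cyclic order. -/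
def gRot : GHalf k Q ρ → GHalf k Q ρ :=
  Sum.map (fun p => ⟨p.1, p.2 + 1⟩) id

/-- The vertex of `Q` (= edge of `Γ_A`) labelling an occurrence. -/
def gLabel : GHalf k Q ρ → Option Q.V :=
  Sum.elim (fun p => Q.vertexAt p.1.1 p.2) (fun i => some i.1)

/-- A witness that `G` is the graph `Γ_A` of the gentle algebra `A = kQ/I`, with the
cyclic ordering of the edges around each vertex induced by the maximal paths of `A`
and multiplicity one at every vertex. -/
structure GentleGraphWitness (G : BrauerGraph) where
  φ : G.H ≃ GHalf k Q ρ
  rot : ∀ h, φ (G.σ h) = gRot k Q ρ (φ h)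
  label : ∀ h, gLabel k Q ρ (φ (G.ε h)) = gLabel k Q ρ (φ h)
  multOne : ∀ h, G.mult h = 1

/-- `G` is (isomorphic to) the graph `Γ_A` of the gentle algebra `A = kQ/I`. -/
def IsGraphOfGentle (G : BrauerGraph) : Prop := Nonempty (GentleGraphWitness k Q ρ G)

end GraphOf

/-! ## Jacobson radical and socle (as a bimodule) -/

/-- The Jacobson radical (intersection of the maximal left ideals). -/
def leftMaxRad (B : Type) [Ring B] : Ideal B := sInf {J : Ideal B | J.IsMaximal}

/-- The socle of `B` as a bimodule over itself: the set of elements annihilated on both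
sides by the Jacobson radical, as a `k`-submodule of `B`. -/
def socleBimod (k : Type) [Field k] (B : Type) [Ring B] [Algebra k B] : Submodule k B where
  carrier := {x | ∀ r ∈ leftMaxRad B, r * x = 0 ∧ x * r = 0}
  add_mem' := by
    intro x y hx hy r hr
    rcases hx r hr with ⟨h1, h2⟩
    rcases hy r hr with ⟨h3, h4⟩
    constructor
    · rw [mul_add, h1, h3, add_zero]
    · rw [add_mul, h2, h4, add_zero]
  zero_mem' := by
    intro r hr
    simp
  smul_mem' := by
    intro c x hx r hr
    rcases hx r hr with ⟨h1, h2⟩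
    constructor
    · rw [mul_smul_comm, h1, smul_zero]
    · rw [smul_mul_assoc, h2, smul_zero]

section Socle

variable {k : Type} [Field k] {Q : FinQuiver} {ρ : Set (PathAlg k Q)}

/-- Universal property of the bound quiver algebra for quadratic monomial relations. -/
lemma exists_bqa_lift (h3 : CondS3 k Q ρ) {B : Type} [Ring B] [Algebra k B]
    (e : Q.V → B) (α : Q.A → B)
    (h1 : ∀ i j, i ≠ j → e i * e j = 0) (h2 : ∀ i, e i * e i = e i) (hs : ∑ i, e i = 1)
    (hl : ∀ a, e (Q.src a) * α a = α a) (hr : ∀ a, α a * e (Q.tgt a) = α a)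
    (hρ : ∀ a b, paArrow k Q a * paArrow k Q b ∈ ρ → α a * α b = 0) :
    ∃ f : BQA k Q ρ →ₐ[k] B, (∀ i, f (bq k Q ρ (paIdem k Q i)) = e i) ∧
      ∀ a, f (bq k Q ρ (paArrow k Q a)) = α a := by
  let g0 : FreeAlgebra k (Q.V ⊕ Q.A) →ₐ[k] B := FreeAlgebra.lift k (Sum.elim e α)
  have hg0 : ∀ ⦃x y⦄, pathAlgRel k Q x y → g0 x = g0 y := by
    rintro x y ⟨rfl, h⟩
    rcases h with ⟨i, j, hij, rfl⟩ | ⟨i, rfl⟩ | rfl | ⟨a, rfl⟩ | ⟨a, rfl⟩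
    · simp [g0, h1 i j hij]
    · simp [g0, h2]
    · simp [g0, hs]
    · simp [g0, hl]
    · simp [g0, hr]
  let g1 : PathAlg k Q →ₐ[k] B := RingQuot.liftAlgHom k ⟨g0, hg0⟩
  have hg1i : ∀ i, g1 (paIdem k Q i) = e i := by
    intro i
    have : g1 (paIdem k Q i) = g0 (FreeAlgebra.ι k (Sum.inl i)) :=
      RingQuot.liftAlgHom_mkAlgHom_apply k g0 hg0 _
    rw [this]; simp [g0]
  have hg1a : ∀ a, g1 (paArrow k Q a) = α a := by
    intro i
    have : g1 (paArrow k Q i) = g0 (FreeAlgebra.ι k (Sum.inr i)) :=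
      RingQuot.liftAlgHom_mkAlgHom_apply k g0 hg0 _
    rw [this]; simp [g0]
  have hg1 : ∀ ⦃x y⦄, bqaRel k Q ρ x y → g1 x = g1 y := by
    rintro x y ⟨hx, rfl⟩
    obtain ⟨a, b, -, rfl⟩ := h3 x hx
    rw [map_mul, hg1a, hg1a, hρ a b hx, map_zero]
  refine ⟨RingQuot.liftAlgHom k ⟨g1, hg1⟩, fun i => ?_, fun a => ?_⟩
  · rw [← hg1i i]
    exact RingQuot.liftAlgHom_mkAlgHom_apply k g1 hg1 _
  · rw [← hg1a a]
    exact RingQuot.liftAlgHom_mkAlgHom_apply k g1 hg1 _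

/-- start vertex of a word -/
def wStart (w : List Q.A × Q.V) : Q.V := (w.1.head?.map Q.src).getD w.2

/-- the word of a generalized path -/
def gWord : QGPath Q → List Q.A × Q.V :=
  Sum.elim (fun i => ([], i)) (fun l => (l.1, Q.tgt (l.1.getLast l.2.1)))

lemma gWord_injective : Function.Injective (gWord (Q := Q)) := by
  rintro (i | ⟨l, hl⟩) (j | ⟨m, hm⟩) h
  · simp only [gWord, Sum.elim_inl, Prod.mk.injEq, true_and] at h
    rw [h]
  · exact absurd (congrArg Prod.fst h).symm hm.1
  · exact absurd (congrArg Prod.fst h) hl.1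
  · have : l = m := congrArg Prod.fst h
    subst this; rfl

open Classical in
/-- idempotent operator -/
def wE (k : Type) [Field k] (Q : FinQuiver) (i : Q.V) :
    Module.End k ((List Q.A × Q.V) →₀ k) :=
  Finsupp.linearCombination k
    (fun w => if wStart w = i then Finsupp.single w 1 else 0)

open Classical in
/-- arrow operator -/
def wX (ρ : Set (PathAlg k Q)) (a : Q.A) : Module.End k ((List Q.A × Q.V) →₀ k) :=
  Finsupp.linearCombination k
    (fun w => if Q.tgt a = wStart w ∧ ∀ b ∈ w.1.head?, paArrow k Q a * paArrow k Q b ∉ ρ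
      then Finsupp.single (a :: w.1, w.2) 1 else 0)

open Classical in
lemma wE_single (i : Q.V) (w : List Q.A × Q.V) : wE k Q i (Finsupp.single w 1) =
    if wStart w = i then Finsupp.single w 1 else 0 := by
  simp [wE, Finsupp.linearCombination_single]

open Classical in
lemma wX_single (a : Q.A) (w : List Q.A × Q.V) : wX ρ a (Finsupp.single w 1) =
    if Q.tgt a = wStart w ∧ ∀ b ∈ w.1.head?, paArrow k Q a * paArrow k Q b ∉ ρ
      then Finsupp.single (a :: w.1, w.2) 1 else 0 := by
  simp only [wX, Finsupp.linearCombination_single, one_smul]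

lemma wEnd_ext {f g : Module.End k ((List Q.A × Q.V) →₀ k)}
    (h : ∀ w, f (Finsupp.single w 1) = g (Finsupp.single w 1)) : f = g := by
  refine Finsupp.lhom_ext' fun w => LinearMap.ext_ring ?_
  simpa using h w

lemma exists_model (h3 : CondS3 k Q ρ) :
    ∃ f : BQA k Q ρ →ₐ[k] Module.End k ((List Q.A × Q.V) →₀ k),
      (∀ i, f (bq k Q ρ (paIdem k Q i)) = wE k Q i) ∧
      ∀ a, f (bq k Q ρ (paArrow k Q a)) = wX ρ a := by
  classical
  refine exists_bqa_lift h3 (wE k Q) (wX ρ) ?_ ?_ ?_ ?_ ?_ ?_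
  · intro i j hij
    refine wEnd_ext fun w => ?_
    rw [Module.End.mul_apply, wE_single]
    split_ifs with h
    · rw [wE_single, if_neg (by rw [h]; exact hij.symm)]; simp
    · simp
  · intro i
    refine wEnd_ext fun w => ?_
    rw [Module.End.mul_apply, wE_single]
    split_ifs with h
    · rw [wE_single, if_pos h]
    · simp
  · refine wEnd_ext fun w => ?_
    rw [LinearMap.sum_apply]
    simp [wE_single]
  · intro a
    refine wEnd_ext fun w => ?_
    rw [Module.End.mul_apply, wX_single]
    split_ifs with h
    · rw [wE_single, if_pos (by simp [wStart])]
    · simp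
  · intro a
    refine wEnd_ext fun w => ?_
    rw [Module.End.mul_apply, wE_single]
    split_ifs with h
    · rfl
    · rw [wX_single, if_neg (fun h' => h h'.1.symm)]; simp
  · intro a b hab
    refine wEnd_ext fun w => ?_
    rw [Module.End.mul_apply, wX_single]
    split_ifs with h
    · rw [wX_single, if_neg (fun h' => h'.2 b (by simp) hab)]; simp
    · simp

lemma bq_rel {x : PathAlg k Q} (hx : x ∈ ρ) : bq k Q ρ x = 0 := by
  have h0 := RingQuot.mkAlgHom_rel k (show bqaRel k Q ρ x 0 from ⟨hx, rfl⟩)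
  rw [map_zero] at h0
  exact h0

lemma paPath_cons (a : Q.A) (l : List Q.A) :
    paPath k Q (a :: l) = paArrow k Q a * paPath k Q l := by
  simp [paPath]

lemma paPath_append (l m : List Q.A) :
    paPath k Q (l ++ m) = paPath k Q l * paPath k Q m := by
  simp [paPath]

lemma paPath_single (a : Q.A) : paPath k Q [a] = paArrow k Q a := by
  simp [paPath]

/-- Linear functional-valued model: nonzero paths go to distinct basis vectors. -/
lemma exists_Phi (h3 : CondS3 k Q ρ) :
    ∃ Φ : BQA k Q ρ →ₗ[k] ((List Q.A × Q.V) →₀ k),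
      ∀ p : QGPath Q, bq k Q ρ (paG k Q p) ≠ 0 →
        Φ (bq k Q ρ (paG k Q p)) = Finsupp.single (gWord p) 1 := by
  classical
  obtain ⟨f, fe, fa⟩ := exists_model h3
  refine ⟨(LinearMap.applyₗ (∑ v : Q.V, Finsupp.single (([] : List Q.A), v) (1 : k))).comp
    f.toLinearMap, ?_⟩
  have key : ∀ l : List Q.A, ∀ hl : Q.IsPath l, bq k Q ρ (paPath k Q l) ≠ 0 →
      f (bq k Q ρ (paPath k Q l)) (∑ v : Q.V, Finsupp.single (([] : List Q.A), v) (1 : k)) =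
        Finsupp.single (l, Q.tgt (l.getLast hl.1)) 1 := by
    intro l
    induction l with
    | nil => intro hl; exact absurd rfl hl.1
    | cons a l ih =>
      intro hl hne
      cases l with
      | nil =>
        rw [paPath_single, fa, map_sum]
        simp only [wX_single]
        simp [wStart]
      | cons b l =>
        have hc : Q.tgt a = Q.src b ∧ List.IsChain (fun a b => Q.tgt a = Q.src b) (b :: l) :=
          List.isChain_cons_cons.mp hl.2
        have hR : paArrow k Q a * paArrow k Q b ∉ ρ := by
          intro h
          apply hne
          rw [paPath_cons, paPath_cons, ← mul_assoc, map_mul, bq_rel h, zero_mul]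
        have hne' : bq k Q ρ (paPath k Q (b :: l)) ≠ 0 := by
          intro h
          apply hne
          rw [paPath_cons, map_mul, h, mul_zero]
        have := ih ⟨by simp, hc.2⟩ hne'
        rw [paPath_cons, map_mul, map_mul, Module.End.mul_apply, this, fa, wX_single,
          if_pos ⟨by simp [wStart, hc.1], by simpa using hR⟩]
        simp
  rintro (i | ⟨l, hl⟩) hne
  · show f (bq k Q ρ (paIdem k Q i)) _ = _
    rw [fe, map_sum]
    rw [Finset.sum_eq_single i]
    · rw [wE_single, if_pos (by simp [wStart])]; rfl
    · intro j _ hj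
      rw [wE_single, if_neg (by simpa [wStart] using hj)]
    · simp
  · exact key l hl hne

/-- Left multiplication of a generalized path by an arrow. -/
lemma arrow_mul_paG (a : Q.A) (p : QGPath Q) :
    paArrow k Q a * paG k Q p = 0 ∨ ∃ q : QGPath Q, paArrow k Q a * paG k Q p = paG k Q q ∧
      gWord q = (a :: (gWord p).1, (gWord p).2) := by
  rcases p with i | ⟨l, hl⟩
  · by_cases h : Q.tgt a = i
    · subst h
      refine Or.inr ⟨Sum.inr ⟨[a], by simp, List.isChain_singleton _⟩, ?_, ?_⟩
      · show _ * paIdem k Q _ = paPath k Q [a]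
        rw [paArrow_mul_tgt, paPath_single]
      · simp [gWord]
    · left
      show _ * paIdem k Q _ = 0
      rw [← paArrow_mul_tgt, mul_assoc, paIdem_mul_paIdem_ne k Q h, mul_zero]
  · cases l with
    | nil => exact absurd rfl hl.1
    | cons b l =>
      by_cases h : Q.tgt a = Q.src b
      · refine Or.inr ⟨Sum.inr ⟨a :: b :: l, by simp, List.isChain_cons_cons.mpr ⟨h, hl.2⟩⟩, ?_, ?_⟩
        · exact (paPath_cons _ _).symm
        · simp [gWord]
      · left
        show _ * paPath k Q (b :: l) = 0
        rw [paPath_cons, ← mul_assoc, ← paArrow_mul_tgt, ← paIdem_src_mul k Q b,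
          mul_assoc (paArrow k Q a), ← mul_assoc (paIdem k Q (Q.tgt a)),
          paIdem_mul_paIdem_ne k Q h]
        simp

/-- Right multiplication of a generalized path by an arrow. -/
lemma paG_mul_arrow (a : Q.A) (p : QGPath Q) :
    paG k Q p * paArrow k Q a = 0 ∨ ∃ q : QGPath Q, paG k Q p * paArrow k Q a = paG k Q q ∧
      gWord q = ((gWord p).1 ++ [a], Q.tgt a) ∧ (gWord p).2 = Q.src a := by
  rcases p with i | ⟨l, hl⟩
  · by_cases h : i = Q.src a
    · subst h
      refine Or.inr ⟨Sum.inr ⟨[a], by simp, List.isChain_singleton _⟩, ?_, ?_⟩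
      · show paIdem k Q _ * _ = paPath k Q [a]
        rw [paIdem_src_mul, paPath_single]
      · simp [gWord]
    · left
      show paIdem k Q _ * _ = 0
      rw [← paIdem_src_mul, ← mul_assoc, paIdem_mul_paIdem_ne k Q h, zero_mul]
  · rcases List.eq_nil_or_concat l with rfl | ⟨l, b, rfl⟩
    · exact absurd rfl hl.1
    · simp only [List.concat_eq_append] at hl ⊢
      by_cases h : Q.tgt b = Q.src a
      · refine Or.inr ⟨Sum.inr ⟨(l ++ [b]) ++ [a], by simp,
          List.isChain_append.mpr ⟨hl.2, List.isChain_singleton _, ?_⟩⟩, ?_, ?_⟩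
        · simpa using h
        · show paPath k Q (l ++ [b]) * _ = paPath k Q _
          rw [paPath_append (l ++ [b]), paPath_single]
        · simp [gWord, h]
      · left
        show paPath k Q (l ++ [b]) * _ = 0
        rw [paPath_append, paPath_single, mul_assoc, ← paArrow_mul_tgt, ← paIdem_src_mul k Q a,
          mul_assoc (paArrow k Q b), ← mul_assoc (paIdem k Q (Q.tgt b)),
          paIdem_mul_paIdem_ne k Q h]
        simp

lemma idem_mul_paG (i : Q.V) (p : QGPath Q) :
    paIdem k Q i * paG k Q p = 0 ∨ paIdem k Q i * paG k Q p = paG k Q p := by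
  rcases p with j | ⟨l, hl⟩
  · by_cases h : i = j
    · subst h; exact Or.inr (paIdem_mul_self k Q i)
    · exact Or.inl (paIdem_mul_paIdem_ne k Q h)
  · cases l with
    | nil => exact absurd rfl hl.1
    | cons b l =>
      show paIdem k Q i * paPath k Q (b :: l) = 0 ∨ paIdem k Q i * paPath k Q (b :: l) =
        paPath k Q (b :: l)
      rw [paPath_cons, ← mul_assoc]
      by_cases h : i = Q.src b
      · subst h; right; rw [paIdem_src_mul]
      · left; rw [← paIdem_src_mul k Q b, ← mul_assoc (paIdem k Q i),
          paIdem_mul_paIdem_ne k Q h]; simp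

/-- The projection from the free algebra to the path algebra. -/
def paMk (k : Type) [Field k] (Q : FinQuiver) : FreeAlgebra k (Q.V ⊕ Q.A) →ₐ[k] PathAlg k Q :=
  RingQuot.mkAlgHom k (pathAlgRel k Q)

lemma span_paG : Submodule.span k (Set.range (paG k Q)) = ⊤ := by
  rw [eq_top_iff]
  rintro y -
  have hmul : ∀ z : FreeAlgebra k (Q.V ⊕ Q.A),
      ∀ s ∈ Submodule.span k (Set.range (paG k Q)),
        paMk k Q z * s ∈
          Submodule.span k (Set.range (paG k Q)) := by
    intro z
    induction z using FreeAlgebra.induction with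
    | grade0 r =>
      intro s hs
      rw [AlgHom.commutes]
      have := Submodule.smul_mem _ r hs
      rw [Algebra.smul_def] at this
      exact this
    | grade1 x =>
      intro s hs
      induction hs using Submodule.span_induction with
      | mem s hs =>
        obtain ⟨p, rfl⟩ := hs
        rcases x with i | a
        · rcases idem_mul_paG (k := k) i p with h | h
          · have : paIdem k Q i * paG k Q p ∈ Submodule.span k (Set.range (paG k Q)) := by
              rw [h]; exact Submodule.zero_mem _
            exact this
          · have : paIdem k Q i * paG k Q p ∈ Submodule.span k (Set.range (paG k Q)) := by
              rw [h]; exact Submodule.subset_span ⟨p, rfl⟩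
            exact this
        · rcases arrow_mul_paG (k := k) a p with h | ⟨q, h, -⟩
          · have : paArrow k Q a * paG k Q p ∈ Submodule.span k (Set.range (paG k Q)) := by
              rw [h]; exact Submodule.zero_mem _
            exact this
          · have : paArrow k Q a * paG k Q p ∈ Submodule.span k (Set.range (paG k Q)) := by
              rw [h]; exact Submodule.subset_span ⟨q, rfl⟩
            exact this
      | zero => rw [mul_zero]; exact Submodule.zero_mem _
      | add x y _ _ hx hy => rw [mul_add]; exact Submodule.add_mem _ hx hy
      | smul c x _ hx => rw [mul_smul_comm]; exact Submodule.smul_mem _ c hx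
    | mul x y hx hy =>
      intro s hs
      rw [map_mul]
      have := hx _ (hy s hs)
      rw [← mul_assoc] at this
      exact this
    | add x y hx hy =>
      intro s hs
      rw [map_add]
      have := Submodule.add_mem _ (hx s hs) (hy s hs)
      rw [← add_mul] at this
      exact this
  have h1 : (1 : PathAlg k Q) ∈ Submodule.span k (Set.range (paG k Q)) := by
    rw [← paIdem_sum]
    exact Submodule.sum_mem _ fun i _ => Submodule.subset_span ⟨Sum.inl i, rfl⟩
  obtain ⟨z, rfl⟩ := RingQuot.mkAlgHom_surjective k (pathAlgRel k Q) y
  have := hmul z 1 h1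
  rw [mul_one] at this
  exact this

lemma bq_surjective : Function.Surjective (bq k Q ρ) :=
  RingQuot.mkAlgHom_surjective k (bqaRel k Q ρ)

lemma span_bq_paG : Submodule.span k (Set.range fun p => bq k Q ρ (paG k Q p)) = ⊤ := by
  have h : (Set.range fun p => bq k Q ρ (paG k Q p)) =
      (bq k Q ρ).toLinearMap '' Set.range (paG k Q) := by
    rw [← Set.range_comp]; rfl
  rw [h, Submodule.span_image, span_paG, Submodule.map_top, LinearMap.range_eq_top]
  exact bq_surjective

/-- The span of the long paths. -/
def longSpan (k : Type) [Field k] (Q : FinQuiver) (ρ : Set (PathAlg k Q)) (n : ℕ) :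
    Submodule k (BQA k Q ρ) :=
  Submodule.span k {y | ∃ l : List Q.A, n ≤ l.length ∧ y = bq k Q ρ (paPath k Q l)}

lemma longSpan_mul {m n : ℕ} {x y : BQA k Q ρ} (hx : x ∈ longSpan k Q ρ m)
    (hy : y ∈ longSpan k Q ρ n) : x * y ∈ longSpan k Q ρ (m + n) := by
  have := Submodule.mul_mem_mul hx hy
  rw [longSpan, longSpan, Submodule.span_mul_span] at this
  refine Submodule.span_mono ?_ this
  rintro _ ⟨_, ⟨l, hl, rfl⟩, _, ⟨l', hl', rfl⟩, rfl⟩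
  refine ⟨l ++ l', by simp; omega, ?_⟩
  simp only [paPath_append, map_mul]

lemma longSpan_pow {x : BQA k Q ρ} (hx : x ∈ longSpan k Q ρ 1) (n : ℕ) :
    x ^ n ∈ longSpan k Q ρ n := by
  induction n with
  | zero => exact Submodule.subset_span ⟨[], by simp, by simp [paPath]⟩
  | succ n ih => rw [pow_succ]; exact longSpan_mul ih hx

lemma mul_arrow_mem_longSpan (b : BQA k Q ρ) (a : Q.A) :
    b * bq k Q ρ (paArrow k Q a) ∈ longSpan k Q ρ 1 := by
  have hb : b ∈ Submodule.span k (Set.range fun p => bq k Q ρ (paG k Q p)) := by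
    rw [span_bq_paG]; trivial
  induction hb using Submodule.span_induction with
  | mem s hs =>
    obtain ⟨p, rfl⟩ := hs
    show bq k Q ρ (paG k Q p) * _ ∈ _
    rw [← map_mul]
    rcases p with i | ⟨l, hl⟩
    · by_cases h : i = Q.src a
      · subst h
        show bq k Q ρ (paIdem k Q _ * _) ∈ _
        rw [paIdem_src_mul]
        exact Submodule.subset_span ⟨[a], by simp, by rw [paPath_single]⟩
      · show bq k Q ρ (paIdem k Q _ * _) ∈ _
        rw [← paIdem_src_mul, ← mul_assoc, paIdem_mul_paIdem_ne k Q h, zero_mul, map_zero]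
        exact Submodule.zero_mem _
    · refine Submodule.subset_span ⟨l ++ [a], by simp, ?_⟩
      rw [paPath_append, paPath_single]; rfl
  | zero => rw [zero_mul]; exact Submodule.zero_mem _
  | add x y _ _ hx hy => rw [add_mul]; exact Submodule.add_mem _ hx hy
  | smul c x _ hx => rw [smul_mul_assoc]; exact Submodule.smul_mem _ c hx

lemma arrow_mem_rad (hadm : IsAdmissibleRels k Q ρ) (a : Q.A) :
    bq k Q ρ (paArrow k Q a) ∈ leftMaxRad (BQA k Q ρ) := by
  obtain ⟨n, hn⟩ := hadm.1
  rw [leftMaxRad, Submodule.mem_sInf]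
  intro J hJ
  by_contra hmem
  obtain ⟨b, hb⟩ := (Ideal.IsMaximal.exists_inv hJ hmem)
  obtain ⟨j, hj, hbj⟩ := hb
  have hnil : IsNilpotent (b * bq k Q ρ (paArrow k Q a)) := by
    refine ⟨n, ?_⟩
    have h := longSpan_pow (mul_arrow_mem_longSpan b a) n
    have h0 : longSpan k Q ρ n ≤ ⊥ := by
      rw [longSpan, Submodule.span_le]
      rintro _ ⟨l, hl, rfl⟩
      exact hn l hl
    exact h0 h
  have hu := hnil.isUnit_one_sub
  have : j = 1 - b * bq k Q ρ (paArrow k Q a) := by rw [← hbj]; abel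
  rw [← this] at hu
  exact hJ.ne_top (Ideal.eq_top_of_isUnit_mem J hj hu)

/-- The radical is contained in the arrow ideal. -/
lemma rad_le_longSpan (h3 : CondS3 k Q ρ) {r : BQA k Q ρ} (hr : r ∈ leftMaxRad (BQA k Q ρ)) :
    r ∈ longSpan k Q ρ 1 := by
  classical
  have hchi : ∀ i : Q.V, ∃ f : BQA k Q ρ →ₐ[k] k,
      (∀ j, f (bq k Q ρ (paIdem k Q j)) = if j = i then 1 else 0) ∧
      ∀ a, f (bq k Q ρ (paArrow k Q a)) = 0 := by
    intro i
    refine exists_bqa_lift h3 (fun j => if j = i then (1 : k) else 0) (fun _ => 0)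
      ?_ ?_ ?_ ?_ ?_ ?_
    · intro j j' h
      by_cases h1 : j = i
      · subst h1; simp [h.symm]
      · simp [h1]
    · intro j; simp
    · simp
    · simp
    · simp
    · simp
  choose χ hχe hχa using hchi
  have hdec : ∀ x : BQA k Q ρ,
      x - ∑ i, χ i x • bq k Q ρ (paIdem k Q i) ∈ longSpan k Q ρ 1 := by
    intro b
    have hb : b ∈ Submodule.span k (Set.range fun p => bq k Q ρ (paG k Q p)) := by
      rw [span_bq_paG]; trivial
    induction hb using Submodule.span_induction with
    | mem s hs =>
      obtain ⟨p, rfl⟩ := hs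
      rcases p with j | ⟨l, hl⟩
      · show bq k Q ρ (paIdem k Q j) - ∑ i, χ i (bq k Q ρ (paIdem k Q j)) • _ ∈ _
        simp [hχe]
      · show bq k Q ρ (paPath k Q l) - ∑ i, χ i (bq k Q ρ (paPath k Q l)) • _ ∈ _
        cases l with
        | nil => exact absurd rfl hl.1
        | cons a l =>
          have : ∀ i, χ i (bq k Q ρ (paPath k Q (a :: l))) = 0 := by
            intro i; rw [paPath_cons, map_mul, map_mul, hχa, zero_mul]
          simp only [this, zero_smul, Finset.sum_const_zero, sub_zero]
          exact Submodule.subset_span ⟨a :: l, by simp, rfl⟩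
    | zero => simp
    | add x y _ _ hx hy =>
      have := Submodule.add_mem _ hx hy
      convert this using 1
      simp only [map_add, add_smul, Finset.sum_add_distrib]
      abel
    | smul c x _ hx =>
      have := Submodule.smul_mem _ c hx
      convert this using 1
      simp only [map_smul, smul_sub, Finset.smul_sum, smul_assoc]
  have h0 : ∀ i, χ i r = 0 := by
    intro i
    have hmax : (RingHom.ker (χ i)).IsMaximal :=
      RingHom.ker_isMaximal_of_surjective (χ i) fun z => ⟨algebraMap k _ z, by simp⟩
    rw [leftMaxRad, Submodule.mem_sInf] at hr
    exact hr _ hmax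
  have := hdec r
  simpa [h0] using this

/-- If a linear operator sends paths to zero or injectively to paths, then the coefficients of
an element of its kernel vanish at all paths not killed. -/
lemma coeff_zero (h3 : CondS3 k Q ρ) (T : BQA k Q ρ →ₗ[k] BQA k Q ρ)
    (g : List Q.A × Q.V → List Q.A × Q.V) (D : Set (List Q.A × Q.V)) (hg : Set.InjOn g D)
    (hT : ∀ p : QGPath Q, T (bq k Q ρ (paG k Q p)) = 0 ∨
      ∃ q, T (bq k Q ρ (paG k Q p)) = bq k Q ρ (paG k Q q) ∧ gWord q = g (gWord p) ∧
        gWord p ∈ D)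
    (c : QGPath Q →₀ k) (hc : T (c.sum fun p r => r • bq k Q ρ (paG k Q p)) = 0)
    (p : QGPath Q) (hp : T (bq k Q ρ (paG k Q p)) ≠ 0) : c p = 0 := by
  classical
  obtain ⟨Φ, hΦ⟩ := exists_Phi h3
  have hval : ∀ p, T (bq k Q ρ (paG k Q p)) ≠ 0 →
      Φ (T (bq k Q ρ (paG k Q p))) = Finsupp.single (g (gWord p)) 1 ∧ gWord p ∈ D := by
    intro p hp
    rcases hT p with h | ⟨q, h, hw, hD⟩
    · exact absurd h hp
    · rw [h] at hp ⊢
      rw [hΦ q hp, hw]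
      exact ⟨rfl, hD⟩
  have h1 := DFunLike.congr_fun (congrArg Φ hc) (g (gWord p))
  rw [Finsupp.sum, map_sum, map_sum, map_zero, Finsupp.finsetSum_apply] at h1
  rw [Finset.sum_eq_single p] at h1
  · rw [map_smul, map_smul, (hval p hp).1] at h1
    simpa using h1
  · intro q _ hqp
    rw [map_smul, map_smul]
    by_cases hq : T (bq k Q ρ (paG k Q q)) = 0
    · simp [hq]
    · rw [(hval q hq).1, Finsupp.smul_apply, Finsupp.single_apply, if_neg, smul_zero]
      intro h
      exact hqp (gWord_injective (hg (hval q hq).2 (hval p hp).2 h))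
  · intro h
    rw [Finsupp.notMem_support_iff.mp h]
    simp

lemma maxG_mem_socle (h3 : CondS3 k Q ρ) (p : QGPath Q) (hp : IsMaxGPath k Q ρ p) :
    bq k Q ρ (paG k Q p) ∈ socleBimod k (BQA k Q ρ) := by
  intro r hr
  have hr' := rad_le_longSpan h3 hr
  clear hr
  unfold longSpan at hr'
  induction hr' using Submodule.span_induction with
  | mem s hs =>
    obtain ⟨l, hl, rfl⟩ := hs
    constructor
    · rcases List.eq_nil_or_concat l with rfl | ⟨l, b, rfl⟩
      · simp at hl
      · rw [List.concat_eq_append, paPath_append, paPath_single, ← map_mul, mul_assoc, map_mul,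
          (hp.2 b).1, mul_zero]
    · cases l with
      | nil => simp at hl
      | cons b l =>
        rw [paPath_cons, ← map_mul, ← mul_assoc, map_mul, (hp.2 b).2, zero_mul]
  | zero => simp
  | add x y _ _ hx hy => rw [add_mul, mul_add, hx.1, hx.2, hy.1, hy.2]; simp
  | smul c x _ hx => rw [smul_mul_assoc, mul_smul_comm, hx.1, hx.2]; simp

end Socle

theorem stmt_6 (k : Type) [Field k] [IsAlgClosed k] (Q : FinQuiver) (ρ : Set (PathAlg k Q))
    (hconn : Q.Connected) (hadm : IsAdmissibleRels k Q ρ)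
    (hfd : FiniteDimensional k (BQA k Q ρ)) (hgentle : IsGentlePres k Q ρ) :
    LinearIndependent k
      (fun p : {p : QGPath Q // IsMaxGPath k Q ρ p} => bq k Q ρ (paG k Q p.1)) ∧
    Submodule.span k
      (Set.range (fun p : {p : QGPath Q // IsMaxGPath k Q ρ p} => bq k Q ρ (paG k Q p.1)))
      = socleBimod k (BQA k Q ρ) := by
  have h3 := hgentle.2.2.1
  constructor
  · obtain ⟨Φ, hΦ⟩ := exists_Phi h3
    refine LinearIndependent.of_comp Φ ?_
    have h : (Φ ∘ fun p : {p : QGPath Q // IsMaxGPath k Q ρ p} => bq k Q ρ (paG k Q p.1)) =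
        (fun w => Finsupp.single w (1 : k)) ∘
          (fun p : {p : QGPath Q // IsMaxGPath k Q ρ p} => gWord p.1) := by
      funext p
      exact hΦ p.1 p.2.1
    rw [h]
    exact (Finsupp.linearIndependent_single_one k _).comp _
      (gWord_injective.comp Subtype.val_injective)
  · apply le_antisymm
    · rw [Submodule.span_le]
      rintro _ ⟨p, rfl⟩
      exact maxG_mem_socle h3 p.1 p.2
    · intro x hx
      have hx' : x ∈ Submodule.span k (Set.range fun p => bq k Q ρ (paG k Q p)) := by
        rw [span_bq_paG]; trivial
      obtain ⟨c, rfl⟩ := Finsupp.mem_span_range_iff_exists_finsupp.mp hx'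
      refine Submodule.sum_mem _ fun p hpc => ?_
      have hcp := Finsupp.mem_support_iff.mp hpc
      by_cases h0 : bq k Q ρ (paG k Q p) = 0
      · simp [h0]
      refine Submodule.smul_mem _ _ (Submodule.subset_span ⟨⟨p, h0, fun a => ?_⟩, rfl⟩)
      obtain ⟨hl, hr⟩ := hx _ (arrow_mem_rad hadm a)
      rw [map_mul, map_mul]
      constructor
      · by_contra hne
        refine hcp (coeff_zero h3 (LinearMap.mulLeft k (bq k Q ρ (paArrow k Q a)))
          (fun w => (a :: w.1, w.2)) Set.univ ?_ ?_ c hl p hne)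
        · rintro ⟨l, v⟩ - ⟨l', v'⟩ - h
          simpa using h
        · intro q
          rw [LinearMap.mulLeft_apply, ← map_mul]
          rcases arrow_mul_paG (k := k) a q with h | ⟨q', h, hw⟩
          · left; rw [h, map_zero]
          · right; exact ⟨q', by rw [h], hw, trivial⟩
      · by_contra hne
        refine hcp (coeff_zero h3 (LinearMap.mulRight k (bq k Q ρ (paArrow k Q a)))
          (fun w => (w.1 ++ [a], Q.tgt a)) {w | w.2 = Q.src a} ?_ ?_ c hr p hne)
        · rintro ⟨l, v⟩ hv ⟨l', v'⟩ hv' h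
          have e1 : v = Q.src a := hv
          have e2 : v' = Q.src a := hv'
          subst e1
          simpa [e2] using h
        · intro q
          rw [LinearMap.mulRight_apply, ← map_mul]
          rcases paG_mul_arrow (k := k) a q with h | ⟨q', h, hw⟩
          · left; rw [h, map_zero]
          · right; exact ⟨q', by rw [h], hw⟩
end
end

section
/- Let A = kQ/I be a finite dimensional gentle algebra over an algebraically closed field, let Γ_A be its graph with cyclic ordering of the edges around each vertex induced by the maximal paths of A, regarded as a Brauer graph with multiplicity one at every vertex, and let Q_E be the quiver obtained from Q by adding, for each nontrivial maximal path m of (Q,I), one arrow β_m from t(m) to s(m). Then Q_E is the quiver of the Brauer graph algebra associated to Γ_A. -/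
set_option maxHeartbeats 1000000

noncomputable section

open scoped BigOperators

/-! ## Auxiliary material for the proof -/

section Aux

/-- Forward uniqueness of maximal chains. -/
lemma aux_fwd {α : Type} (R : α → α → Prop) (hR : ∀ a b c, R a b → R a c → b = c) :
    ∀ (s s' : List α) (a : α), List.IsChain R (a :: s) → List.IsChain R (a :: s') →
      (∀ x ∈ (a :: s).getLast?, ∀ b, ¬ R x b) → (∀ x ∈ (a :: s').getLast?, ∀ b, ¬ R x b) →
      s = s' := by
  intro s
  induction s with
  | nil =>
    intro s' a _ h2 h3 _
    cases s' with
    | nil => rfl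
    | cons c t =>
      rw [List.isChain_cons_cons] at h2
      exact absurd h2.1 (h3 a (by simp) c)
  | cons b s ih =>
    intro s' a h1 h2 h3 h4
    cases s' with
    | nil =>
      rw [List.isChain_cons_cons] at h1
      exact absurd h1.1 (h4 a (by simp) b)
    | cons c t =>
      rw [List.isChain_cons_cons] at h1 h2
      have hbc := hR a b c h1.1 h2.1
      subst hbc
      rw [ih t b h1.2 h2.2 (by simpa [List.getLast?_cons_cons] using h3)
        (by simpa [List.getLast?_cons_cons] using h4)]

/-- Maximal chains for a relation. -/
def AuxMax {α : Type} (R : α → α → Prop) (l : List α) : Prop :=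
  l ≠ [] ∧ List.IsChain R l ∧ (∀ x ∈ l.head?, ∀ b, ¬ R b x) ∧ (∀ x ∈ l.getLast?, ∀ b, ¬ R x b)

lemma aux_unique {α : Type} (R : α → α → Prop) (hR : ∀ a b c, R a b → R a c → b = c)
    (hR' : ∀ a b c, R b a → R c a → b = c) (l₁ s l₁' s' : List α) (a : α)
    (h : AuxMax R (l₁ ++ a :: s)) (h' : AuxMax R (l₁' ++ a :: s')) : l₁ = l₁' ∧ s = s' := by
  constructor
  · have key := aux_fwd (fun x y => R y x) (fun a b c => hR' a b c) l₁.reverse l₁'.reverse a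
    have e : ∀ l s : List α, AuxMax R (l ++ a :: s) →
        List.IsChain (fun x y => R y x) (a :: l.reverse) ∧
        (∀ x ∈ (a :: l.reverse).getLast?, ∀ b, ¬ R b x) := by
      intro l s hm
      have h0 : l ++ a :: s = (l ++ [a]) ++ s := by simp
      have hc := hm.2.1
      rw [h0] at hc
      have hc1 := (List.isChain_append.1 hc).1
      have hr : a :: l.reverse = (l ++ [a]).reverse := by simp
      rw [hr, List.isChain_reverse, List.getLast?_reverse]
      refine ⟨hc1, ?_⟩
      have := hm.2.2.1
      intro x hx
      apply this x
      cases l <;> simpa using hx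
    have := key (e _ _ h).1 (e _ _ h').1 (e _ _ h).2 (e _ _ h').2
    exact List.reverse_injective this
  · refine aux_fwd R hR s s' a (List.isChain_append.1 h.2.1).2.1
      (List.isChain_append.1 h'.2.1).2.1 ?_ ?_
    · have := h.2.2.2
      simpa [List.getLast?_append] using this
    · have := h'.2.2.2
      simpa [List.getLast?_append] using this

lemma aux_exists {α : Type} (R : α → α → Prop) (n : ℕ)
    (hn : ∀ l : List α, l ≠ [] → List.IsChain R l → l.length < n) (a : α) :
    ∃ l, AuxMax R l ∧ a ∈ l := by
  classical
  let P : ℕ → Prop := fun m => ∃ l : List α, l.length = m ∧ List.IsChain R l ∧ a ∈ l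
  have h1 : P 1 := ⟨[a], by simp, by simp, by simp⟩
  have hb : ∀ m, P m → m ≤ n := by
    rintro m ⟨l, rfl, hc, ha⟩
    exact (hn l (List.ne_nil_of_mem ha) hc).le
  obtain ⟨l, hl, hc, ha⟩ : P (Nat.findGreatest P n) := Nat.findGreatest_spec (hb 1 h1) h1
  have hmax : ∀ l' : List α, List.IsChain R l' → a ∈ l' → l'.length ≤ l.length := by
    intro l' hc' ha'
    have hp : P l'.length := ⟨l', rfl, hc', ha'⟩
    rw [hl]
    exact Nat.le_findGreatest (hb _ hp) hp
  refine ⟨l, ⟨List.ne_nil_of_mem ha, hc, ?_, ?_⟩, ha⟩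
  · intro x hx b hR
    have := hmax (b :: l) (by
      rw [List.isChain_cons]
      refine ⟨?_, hc⟩
      intro y hy
      rw [Option.mem_unique hy hx]; exact hR) (by simp [ha])
    simp at this
  · intro x hx b hR
    have := hmax (l ++ [b]) (by
      rw [List.isChain_append]
      refine ⟨hc, by simp, ?_⟩
      intro y hy z hz
      rw [Option.mem_unique hy hx]
      simp at hz
      subst hz; exact hR) (by simp [ha])
    simp at this

variable (k : Type) [Field k] (Q : FinQuiver) (ρ : Set (PathAlg k Q))

/-- Two arrows have nonzero product. -/
def AuxR (a b : Q.A) : Prop := bq k Q ρ (paArrow k Q a * paArrow k Q b) ≠ 0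

lemma auxR_comp {a b : Q.A} (h : AuxR k Q ρ a b) : Q.tgt a = Q.src b := by
  by_contra hne
  apply h
  rw [← paArrow_mul_tgt k Q a, ← paIdem_src_mul k Q b, mul_assoc,
    ← mul_assoc (paIdem k Q (Q.tgt a)), paIdem_mul_paIdem_ne k Q hne]
  simp

lemma aux_chain_of_ne : ∀ l : List Q.A, bq k Q ρ (paPath k Q l) ≠ 0 →
    List.IsChain (AuxR k Q ρ) l := by
  intro l
  induction l with
  | nil => simp
  | cons a l ih =>
    intro h
    have h1 : List.IsChain (AuxR k Q ρ) l := by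
      apply ih
      intro h0
      apply h
      have : paPath k Q (a :: l) = paArrow k Q a * paPath k Q l := by simp [paPath]
      rw [this, map_mul, h0, mul_zero]
    cases l with
    | nil => simp
    | cons b l =>
      rw [List.isChain_cons_cons]
      refine ⟨?_, h1⟩
      intro h0
      apply h
      have : paPath k Q (a :: b :: l) = (paArrow k Q a * paArrow k Q b) * paPath k Q l := by
        simp [paPath, mul_assoc]
      rw [this, map_mul, h0, zero_mul]

open Classical in
/-- The operator of a diagonal idempotent. -/
def auxE (v : ℕ → Q.V) (i : Q.V) : Module.End k (ℕ → k) where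
  toFun f d := if v d = i then f d else 0
  map_add' f g := by ext d; simp only [Pi.add_apply]; split_ifs <;> simp
  map_smul' c f := by ext d; simp

open Classical in
/-- The operator of an arrow. -/
def auxA (l : List Q.A) (a : Q.A) : Module.End k (ℕ → k) where
  toFun f d := if l[d]? = some a then f (d + 1) else 0
  map_add' f g := by ext d; simp only [Pi.add_apply]; split_ifs <;> simp
  map_smul' c f := by ext d; simp

lemma aux_ne_of_chain (h3 : CondS3 k Q ρ) (l : List Q.A) (hne : l ≠ [])
    (hc : List.IsChain (AuxR k Q ρ) l) : bq k Q ρ (paPath k Q l) ≠ 0 := by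
  classical
  let v : ℕ → Q.V := fun d => if h : d < l.length then Q.src l[d] else Q.tgt (l.getLast hne)
  have hv : ∀ d a, l[d]? = some a → v d = Q.src a ∧ v (d + 1) = Q.tgt a := by
    intro d a hda
    obtain ⟨hd, rfl⟩ := List.getElem?_eq_some_iff.1 hda
    refine ⟨by simp [v, hd], ?_⟩
    by_cases h : d + 1 < l.length
    · simp only [v, h, dif_pos]
      exact (auxR_comp k Q ρ (List.isChain_iff_getElem.1 hc d h)).symm
    · simp only [v, h, dif_neg, not_false_eq_true]
      have : d = l.length - 1 := by omega
      subst this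
      rw [List.getLast_eq_getElem]
  let F : FreeAlgebra k (Q.V ⊕ Q.A) →ₐ[k] Module.End k (ℕ → k) :=
    FreeAlgebra.lift k (Sum.elim (auxE k Q v) (auxA k Q l))
  have hF1 : ∀ i, F (FreeAlgebra.ι k (Sum.inl i)) = auxE k Q v i := by
    intro i; simp [F]
  have hF2 : ∀ a, F (FreeAlgebra.ι k (Sum.inr a)) = auxA k Q l a := by
    intro i; simp [F]
  have hF : ∀ ⦃x y⦄, pathAlgRel k Q x y → F x = F y := by
    rintro x y ⟨rfl, h⟩
    rw [map_zero]
    rcases h with ⟨i, j, hij, rfl⟩ | ⟨i, rfl⟩ | rfl | ⟨a, rfl⟩ | ⟨a, rfl⟩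
    · rw [map_mul, hF1, hF1]
      ext f d
      simp only [Module.End.mul_apply, auxE, LinearMap.coe_mk, AddHom.coe_mk]
      split_ifs with h1 h2
      · exact absurd (h1.symm.trans h2) hij
      · rfl
      · rfl
    · rw [map_sub, map_mul, hF1, sub_eq_zero]
      ext f d
      simp only [Module.End.mul_apply, auxE, LinearMap.coe_mk, AddHom.coe_mk]
      split_ifs <;> rfl
    · rw [map_sub, map_sum, map_one, sub_eq_zero]
      simp only [hF1]
      ext f d
      simp [auxE, LinearMap.sum_apply, Finset.sum_apply]
    · rw [map_sub, map_mul, hF1, hF2, sub_eq_zero]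
      ext f d
      simp only [Module.End.mul_apply, auxE, auxA, LinearMap.coe_mk, AddHom.coe_mk]
      by_cases h : l[d]? = some a
      · simp [h, (hv d a h).1]
      · simp [h]
    · rw [map_sub, map_mul, hF1, hF2, sub_eq_zero]
      ext f d
      simp only [Module.End.mul_apply, auxE, auxA, LinearMap.coe_mk, AddHom.coe_mk]
      by_cases h : l[d]? = some a
      · simp [h, (hv d a h).2]
      · simp [h]
  let F' : PathAlg k Q →ₐ[k] Module.End k (ℕ → k) := RingQuot.liftAlgHom k ⟨F, hF⟩
  have hF'2 : ∀ a, F' (paArrow k Q a) = auxA k Q l a := by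
    intro a
    rw [← hF2 a]
    exact RingQuot.liftAlgHom_mkAlgHom_apply k F hF _
  have hF' : ∀ ⦃x y⦄, bqaRel k Q ρ x y → F' x = F' y := by
    rintro x y ⟨hx, rfl⟩
    rw [map_zero]
    obtain ⟨a, b, hab, rfl⟩ := h3 x hx
    have h0 : ¬ AuxR k Q ρ a b := by
      intro h
      apply h
      have := RingQuot.mkAlgHom_rel k (show bqaRel k Q ρ _ 0 from ⟨hx, rfl⟩)
      rw [map_zero] at this
      exact this
    rw [map_mul, hF'2, hF'2]
    ext f d
    simp only [Module.End.mul_apply, auxA, LinearMap.coe_mk, AddHom.coe_mk]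
    split_ifs with h1 h2
    · exfalso
      obtain ⟨hd1, rfl⟩ := List.getElem?_eq_some_iff.1 h1
      obtain ⟨hd2, rfl⟩ := List.getElem?_eq_some_iff.1 h2
      exact h0 (List.isChain_iff_getElem.1 hc d hd2)
    · rfl
    · rfl
  let F'' : BQA k Q ρ →ₐ[k] Module.End k (ℕ → k) := RingQuot.liftAlgHom k ⟨F', hF'⟩
  have hF'' : ∀ x, F'' (bq k Q ρ x) = F' x := by
    intro x
    exact RingQuot.liftAlgHom_mkAlgHom_apply k F' hF' _
  have hprod : ∀ s pre : List Q.A, l = pre ++ s → ∀ f : ℕ → k,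
      F' (paPath k Q s) f pre.length = f l.length := by
    intro s
    induction s with
    | nil =>
      intro pre hpre f
      simp [paPath, hpre]
    | cons a s ih =>
      intro pre hpre f
      have h1 : paPath k Q (a :: s) = paArrow k Q a * paPath k Q s := by simp [paPath]
      have h2 := ih (pre ++ [a]) (by simp [hpre]) f
      rw [h1, map_mul, hF'2, Module.End.mul_apply]
      have h4 : l[pre.length]? = some a := by simp [hpre]
      rw [← h2]
      simp [auxA, h4]
  intro h
  have h1 := hF'' (paPath k Q l)
  rw [h, map_zero] at h1
  have h2 := hprod l [] rfl (fun _ => 1)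
  rw [← h1] at h2
  simp at h2

lemma aux_max_iff (h3 : CondS3 k Q ρ) (l : List Q.A) :
    IsMaximalPath k Q ρ l ↔ AuxMax (AuxR k Q ρ) l := by
  have hcons : ∀ a, paArrow k Q a * paPath k Q l = paPath k Q (a :: l) := by
    intro a; simp [paPath]
  have hsnoc : ∀ a, paPath k Q l * paArrow k Q a = paPath k Q (l ++ [a]) := by
    intro a; simp [paPath]
  constructor
  · rintro ⟨⟨hne, _⟩, hnz, hm⟩
    have hc := aux_chain_of_ne k Q ρ l hnz
    refine ⟨hne, hc, ?_, ?_⟩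
    · intro x hx b hR
      refine aux_ne_of_chain k Q ρ h3 (b :: l) (by simp) ?_ ((hcons b) ▸ (hm b).1)
      rw [List.isChain_cons]
      refine ⟨?_, hc⟩
      intro y hy
      rw [Option.mem_unique hy hx]; exact hR
    · intro x hx b hR
      refine aux_ne_of_chain k Q ρ h3 (l ++ [b]) (by simp) ?_ ((hsnoc b) ▸ (hm b).2)
      rw [List.isChain_append]
      refine ⟨hc, by simp, ?_⟩
      intro y hy z hz
      rw [Option.mem_unique hy hx]
      simp at hz
      subst hz; exact hR
  · rintro ⟨hne, hc, hh, hl⟩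
    refine ⟨⟨hne, hc.imp fun a b h => auxR_comp k Q ρ h⟩,
      aux_ne_of_chain k Q ρ h3 l hne hc, ?_⟩
    intro a
    constructor
    · by_contra h
      rw [hcons] at h
      have := aux_chain_of_ne k Q ρ _ h
      rw [List.isChain_cons] at this
      exact hh (l.head hne) (List.head?_eq_some_head hne) a
        (this.1 _ (List.head?_eq_some_head hne))
    · by_contra h
      rw [hsnoc] at h
      have := aux_chain_of_ne k Q ρ _ h
      rw [List.isChain_append] at this
      exact hl (l.getLast hne) (List.getLast?_eq_some_getLast hne) a
        (this.2.2 _ (List.getLast?_eq_some_getLast hne) a (by simp))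

/-- Positions along nontrivial maximal paths. -/
abbrev AuxX : Type := Σ m : {l : List Q.A // IsMaximalPath k Q ρ l}, Fin (m.1.length + 1)

lemma aux_label_lt (x : AuxX k Q ρ) (h : x.2.val < x.1.1.length) :
    gLabel k Q ρ (Sum.inl x) = some (Q.src (x.1.1[x.2.val])) := by
  simp [gLabel, FinQuiver.vertexAt, h]

lemma aux_label_succ_lt (x : AuxX k Q ρ) (h : x.2.val < x.1.1.length) :
    gLabel k Q ρ (gRot k Q ρ (Sum.inl x)) = some (Q.tgt (x.1.1[x.2.val])) := by
  obtain ⟨⟨l, hl⟩, p⟩ := x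
  have hv : (p + 1).val = p.val + 1 := by
    apply Fin.val_add_one_of_lt
    exact h
  dsimp only at h ⊢
  simp only [gLabel, gRot, Sum.map_inl, Sum.elim_inl, FinQuiver.vertexAt, hv]
  by_cases h2 : p.val + 1 < l.length
  · have hc := List.isChain_iff_getElem.1 hl.1.2 p.val h2
    simp [h2, hc]
  · have h4 : p.val + 1 = l.length := by omega
    have h5 : p.val = l.length - 1 := by omega
    simp [h4, List.getLast?_eq_getElem?, ← h5, h]

lemma aux_label_last (x : AuxX k Q ρ) (h : ¬ x.2.val < x.1.1.length) (i : Q.V) :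
    gLabel k Q ρ (Sum.inl x) = some i ↔ Q.EndsAt x.1.1 i := by
  obtain ⟨⟨l, hl⟩, p⟩ := x
  dsimp only at h ⊢
  have h2 : p.val = l.length := by have := p.2; dsimp only at this; omega
  simp [gLabel, FinQuiver.vertexAt, h2, FinQuiver.EndsAt]

lemma aux_label_succ_last (x : AuxX k Q ρ) (h : ¬ x.2.val < x.1.1.length) (i : Q.V) :
    gLabel k Q ρ (gRot k Q ρ (Sum.inl x)) = some i ↔ Q.StartsAt x.1.1 i := by
  obtain ⟨⟨l, hl⟩, p⟩ := x
  dsimp only at h ⊢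
  have h2 : p = Fin.last l.length := by
    apply Fin.ext; have := p.2; dsimp only at this; simp; omega
  have h0 : 0 < l.length := List.length_pos_iff.2 hl.1.1
  subst h2
  simp only [gLabel, gRot, Sum.map_inl, Sum.elim_inl, FinQuiver.vertexAt, Fin.last_add_one,
    FinQuiver.StartsAt]
  cases l with
  | nil => simp at h0
  | cons a l => simp

end Aux


/-- **Lemma 3.3.**  Let `A = kQ/I` be a finite dimensional gentle algebra over an
algebraically closed field, let `Γ_A` be its graph with cyclic ordering of the edges
around each vertex induced by the maximal paths of `A`, regarded as a Brauer graph with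
multiplicity one at every vertex.  Then the quiver `Q_E`, obtained from `Q` by adding one
new arrow `β_m : t(m) → s(m)` for each (nontrivial) maximal path `m` of `(Q,I)`, is the
quiver of the Brauer graph algebra associated to `Γ_A`: identifying the edges of `Γ_A`
with the vertices of `Q` (via the labels of the half-edges), for all vertices `i, j` of
`Q` the number of arrows `i → j` in the quiver of `Γ_A` equals the number of arrows
`i → j` in `Q` plus the number of maximal paths from `j` to `i`. -/
theorem stmt_10 (k : Type) [Field k] [IsAlgClosed k] (Q : FinQuiver) (ρ : Set (PathAlg k Q))
    (hconn : Q.Connected) (hadm : IsAdmissibleRels k Q ρ)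
    (hfd : FiniteDimensional k (BQA k Q ρ)) (hgentle : IsGentlePres k Q ρ)
    (G : BrauerGraph) (w : GentleGraphWitness k Q ρ G) :
    ∀ i j : Q.V,
      Nat.card {a : G.quiver.A // gLabel k Q ρ (w.φ a.1) = some i ∧
          gLabel k Q ρ (w.φ (G.σ a.1)) = some j} =
      Nat.card {a : Q.A // Q.src a = i ∧ Q.tgt a = j} +
        Nat.card {l : List Q.A // IsMaximalPath k Q ρ l ∧ Q.StartsAt l j ∧ Q.EndsAt l i} := by
  intro i j
  obtain ⟨hS1, hS2, hS3, hS4⟩ := hgentle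
  have hU : ∀ a b c, AuxR k Q ρ a b → AuxR k Q ρ a c → b = c := fun a b c => (hS2 a b c).1
  have hU' : ∀ a b c, AuxR k Q ρ b a → AuxR k Q ρ c a → b = c := fun a b c => (hS2 a b c).2
  obtain ⟨⟨n, hn⟩, -⟩ := hadm
  have hbd : ∀ l : List Q.A, l ≠ [] → List.IsChain (AuxR k Q ρ) l → l.length < n := by
    intro l hl hc
    by_contra h
    exact aux_ne_of_chain k Q ρ hS3 l hl hc (hn l (by omega))
  -- half-edges carrying an arrow are the positions along nontrivial maximal paths
  have hrot : ∀ x : GHalf k Q ρ, w.φ (G.σ (w.φ.symm x)) = gRot k Q ρ x := by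
    intro x; rw [w.rot, Equiv.apply_symm_apply]
  have hinl : ∀ x : AuxX k Q ρ, G.hasArrow (w.φ.symm (Sum.inl x)) := by
    intro x
    left
    intro h
    have h1 : (Sum.inl x : GHalf k Q ρ) = gRot k Q ρ (Sum.inl x) :=
      (w.φ.apply_symm_apply (Sum.inl x)).symm.trans
        ((congrArg w.φ h).symm.trans (hrot (Sum.inl x)))
    obtain ⟨⟨l, hl⟩, p⟩ := x
    simp only [gRot, Sum.map_inl, Sum.inl.injEq, Sigma.mk.injEq, heq_eq_eq, true_and] at h1
    have h0 : 0 < l.length := List.length_pos_iff.2 hl.1.1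
    have h2 : (1 : Fin (l.length + 1)) = 0 := by
      have := h1.symm
      simpa using this
    have h3 : 1 % (l.length + 1) = 0 := by
      rw [← Fin.val_one', h2]
      rfl
    rw [Nat.mod_eq_of_lt (by omega)] at h3
    omega
  let X := {x : AuxX k Q ρ // gLabel k Q ρ (Sum.inl x) = some i ∧
    gLabel k Q ρ (gRot k Q ρ (Sum.inl x)) = some j}
  let L := {a : G.quiver.A // gLabel k Q ρ (w.φ a.1) = some i ∧
          gLabel k Q ρ (w.φ (G.σ a.1)) = some j}
  let f : X → L := fun x => ⟨⟨w.φ.symm (Sum.inl x.1), hinl x.1⟩, by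
    have h := x.2
    exact ⟨(congrArg (gLabel k Q ρ) (w.φ.apply_symm_apply (Sum.inl x.1))).trans h.1,
      (congrArg (gLabel k Q ρ) (hrot (Sum.inl x.1))).trans h.2⟩⟩
  have hf : Function.Bijective f := by
    constructor
    · intro x y hxy
      have h1 := congrArg (fun z : L => z.1.1) hxy
      have h2 := w.φ.symm.injective h1
      exact Subtype.ext (Sum.inl_injective h2)
    · rintro ⟨⟨h, hh⟩, hl⟩
      obtain ⟨x, rfl⟩ := w.φ.symm.surjective h
      rcases x with x | x
      · refine ⟨⟨x, ?_⟩, rfl⟩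
        exact ⟨(congrArg (gLabel k Q ρ) (w.φ.apply_symm_apply (Sum.inl x))).symm.trans hl.1,
          (congrArg (gLabel k Q ρ) (hrot (Sum.inl x))).symm.trans hl.2⟩
      · exfalso
        rcases hh with hh | hh
        · apply hh
          apply w.φ.injective
          exact (hrot (Sum.inr x)).trans (w.φ.apply_symm_apply (Sum.inr x)).symm
        · rw [w.multOne] at hh
          omega
  let S := {a : Q.A // Q.src a = i ∧ Q.tgt a = j}
  let M := {l : List Q.A // IsMaximalPath k Q ρ l ∧ Q.StartsAt l j ∧ Q.EndsAt l i}
  let g : X → S ⊕ M := fun x =>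
    if h : x.1.2.val < x.1.1.1.length then
      Sum.inl ⟨x.1.1.1[x.1.2.val], by
        have h1 := x.2.1
        have h2 := x.2.2
        rw [aux_label_lt k Q ρ x.1 h] at h1
        rw [aux_label_succ_lt k Q ρ x.1 h] at h2
        exact ⟨Option.some_injective _ h1, Option.some_injective _ h2⟩⟩
    else Sum.inr ⟨x.1.1.1, x.1.1.2, (aux_label_succ_last k Q ρ x.1 h j).1 x.2.2,
      (aux_label_last k Q ρ x.1 h i).1 x.2.1⟩
  have hg : Function.Bijective g := by
    constructor
    · rintro ⟨⟨⟨l, hl⟩, p⟩, hx⟩ ⟨⟨⟨l', hl'⟩, p'⟩, hx'⟩ hxy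
      apply Subtype.ext
      by_cases h : p.val < l.length <;> by_cases h' : p'.val < l'.length
      · simp only [g, h, h', dif_pos, Sum.inl.injEq] at hxy
        replace hxy : l[p.val] = l'[p'.val] := congrArg (fun z : S => z.1) hxy
        have e : l = l.take p.val ++ l[p.val] :: l.drop (p.val + 1) := by simp
        have e' : l' = l'.take p'.val ++ l[p.val] :: l'.drop (p'.val + 1) := by
          rw [hxy]; simp
        have m := (aux_max_iff k Q ρ hS3 l).1 hl
        have m' := (aux_max_iff k Q ρ hS3 l').1 hl'
        rw [e] at m
        rw [e'] at m'
        obtain ⟨u1, u2⟩ := aux_unique _ hU hU' _ _ _ _ _ m m'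
        have hll : l = l' := by
          rw [e, e', ← u1, ← u2]
        subst hll
        have hpp : p = p' := by
          apply Fin.ext
          have := congrArg List.length u1
          simp at this
          omega
        subst hpp
        rfl
      · simp [g, h, h'] at hxy
      · simp [g, h, h'] at hxy
      · simp only [g, h, h', dif_neg, not_false_eq_true, Sum.inr.injEq] at hxy
        replace hxy : l = l' := congrArg (fun z : M => z.1) hxy
        subst hxy
        have hpp : p = p' := by
          apply Fin.ext
          have h1 := p.2
          have h2 := p'.2
          dsimp only at h1 h2
          omega
        subst hpp
        rfl
    · rintro (⟨a, ha⟩ | ⟨l, hl, hs, he⟩)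
      · obtain ⟨l, hl, hal⟩ := aux_exists (AuxR k Q ρ) n hbd a
        obtain ⟨p, hp, rfl⟩ := List.mem_iff_getElem.1 hal
        let x : AuxX k Q ρ := ⟨⟨l, (aux_max_iff k Q ρ hS3 l).2 hl⟩, ⟨p, Nat.lt_succ_of_lt hp⟩⟩
        have hx : x.2.val < x.1.1.length := hp
        refine ⟨⟨x, ?_, ?_⟩, ?_⟩
        · rw [aux_label_lt k Q ρ x hx]
          exact congrArg some ha.1
        · rw [aux_label_succ_lt k Q ρ x hx]
          exact congrArg some ha.2
        · simp only [g, hx, dif_pos]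
          rfl
      · let x : AuxX k Q ρ := ⟨⟨l, hl⟩, Fin.last _⟩
        have hx : ¬ x.2.val < x.1.1.length := by simp [x]
        refine ⟨⟨x, (aux_label_last k Q ρ x hx i).2 he, (aux_label_succ_last k Q ρ x hx j).2 hs⟩, ?_⟩
        simp only [g, hx, dif_neg, not_false_eq_true]
        rfl
  have hfinL : Finite L := inferInstance
  have hfinX : Finite X := Finite.of_injective f hf.1
  have hfinSM : Finite (S ⊕ M) := Finite.of_surjective g hg.2
  have hfinS : Finite S := Finite.of_injective (Sum.inl : S → S ⊕ M) Sum.inl_injective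
  have hfinM : Finite M := Finite.of_injective (Sum.inr : M → S ⊕ M) Sum.inr_injective
  show Nat.card L = Nat.card S + Nat.card M
  rw [← Nat.card_sum, ← Nat.card_congr (Equiv.ofBijective f hf),
    Nat.card_congr (Equiv.ofBijective g hg)]
end
end

section
/- Let Λ = kQ_Λ/I_Λ be a Brauer graph algebra over an algebraically closed field with multiplicity one at every vertex of its Brauer graph, let D be a cutting set of Q_Λ, let Q be the quiver with the same vertices as Q_Λ and arrows (Q_Λ)_1 \ D, and let I = I_Λ ∩ kQ. Then the admissible cut kQ_Λ/J_Λ, where J_Λ is the ideal generated by I_Λ ∪ D, is isomorphic to kQ/I, and the ideal I is generated by paths of length two. -/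
set_option maxHeartbeats 1000000

noncomputable section

open scoped BigOperators

/-- The canonical algebra embedding `kQ → kQ_Λ`, where `Q` is the quiver obtained from
`Q_Λ` by deleting the arrows of the cutting set `D`. -/
def cutEmbed (k : Type) [Field k] (G : BrauerGraph) (D : Set G.quiver.A) :
    PathAlg k (cutQuiver G D) →ₐ[k] PathAlg k G.quiver :=
  RingQuot.liftAlgHom k
    ⟨FreeAlgebra.lift k
        (Sum.elim (fun i => paIdem k G.quiver i) (fun a => paArrow k G.quiver a.1)),
      by
        rintro x y ⟨rfl, hx⟩
        rw [map_zero]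
        rcases hx with ⟨i, j, hij, rfl⟩ | ⟨i, rfl⟩ | rfl | ⟨a, rfl⟩ | ⟨a, rfl⟩
        · simp only [map_mul, FreeAlgebra.lift_ι_apply, Sum.elim_inl]
          exact paIdem_mul_paIdem_ne k G.quiver hij
        · simp only [map_sub, map_mul, FreeAlgebra.lift_ι_apply, Sum.elim_inl]
          exact sub_eq_zero.mpr (paIdem_mul_self k G.quiver i)
        · simp only [map_sub, map_sum, map_one, FreeAlgebra.lift_ι_apply, Sum.elim_inl]
          have hsum : (∑ i : (cutQuiver G D).V, paIdem k G.quiver i)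
              = ∑ i : G.quiver.V, paIdem k G.quiver i := rfl
          rw [hsum, paIdem_sum, sub_self]
        · simp only [map_sub, map_mul, FreeAlgebra.lift_ι_apply, Sum.elim_inl, Sum.elim_inr]
          rw [show (cutQuiver G D).src a = G.quiver.src a.1 from rfl,
            paIdem_src_mul, sub_self]
        · simp only [map_sub, map_mul, FreeAlgebra.lift_ι_apply, Sum.elim_inl, Sum.elim_inr]
          rw [show (cutQuiver G D).tgt a = G.quiver.tgt a.1 from rfl,
            paArrow_mul_tgt, sub_self]⟩

/-- The ideal `I = I_Λ ∩ kQ` of `kQ`: the preimage under the embedding `kQ → kQ_Λ` of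
the ideal `I_Λ` generated by the Brauer graph relations (an element `x` lies in an ideal
iff it dies in the corresponding quotient). -/
def cutIdeal (k : Type) [Field k] (G : BrauerGraph) (D : Set G.quiver.A) :
    Set (PathAlg k (cutQuiver G D)) :=
  {x | bq k G.quiver (brauerRels k G) (cutEmbed k G D x) = 0}

section Helpers

variable (k : Type) [Field k]

lemma bq_mem (Q : FinQuiver) (ρ : Set (PathAlg k Q)) {x : PathAlg k Q} (hx : x ∈ ρ) :
    bq k Q ρ x = 0 := by
  have h0 := RingQuot.mkAlgHom_rel k (show bqaRel k Q ρ x 0 from ⟨hx, rfl⟩)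
  rw [map_zero] at h0
  exact h0

def bqLift (Q : FinQuiver) (ρ : Set (PathAlg k Q)) {B : Type} [Ring B] [Algebra k B]
    (f : PathAlg k Q →ₐ[k] B) (hf : ∀ x ∈ ρ, f x = 0) : BQA k Q ρ →ₐ[k] B :=
  RingQuot.liftAlgHom k ⟨f, by
    rintro x y ⟨hx, rfl⟩
    rw [hf x hx, map_zero]⟩

lemma bqLift_bq (Q : FinQuiver) (ρ : Set (PathAlg k Q)) {B : Type} [Ring B] [Algebra k B]
    (f : PathAlg k Q →ₐ[k] B) (hf : ∀ x ∈ ρ, f x = 0) (x : PathAlg k Q) :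
    bqLift k Q ρ f hf (bq k Q ρ x) = f x :=
  RingQuot.liftAlgHom_mkAlgHom_apply k f _ x

lemma bq_zero_imp (Q : FinQuiver) (ρ : Set (PathAlg k Q)) {B : Type} [Ring B] [Algebra k B]
    (f : PathAlg k Q →ₐ[k] B) (hf : ∀ x ∈ ρ, f x = 0) {x : PathAlg k Q}
    (hx : bq k Q ρ x = 0) : f x = 0 := by
  rw [← bqLift_bq k Q ρ f hf x, hx, map_zero]

lemma bqa_ext (Q : FinQuiver) (ρ : Set (PathAlg k Q)) {B : Type} [Ring B] [Algebra k B]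
    {f g : BQA k Q ρ →ₐ[k] B} (h : ∀ x, f (bq k Q ρ x) = g (bq k Q ρ x)) : f = g := by
  refine RingQuot.ringQuot_ext' k f g ?_
  exact AlgHom.ext h

lemma pa_ext (Q : FinQuiver) {B : Type} [Ring B] [Algebra k B]
    {f g : PathAlg k Q →ₐ[k] B} (h1 : ∀ i, f (paIdem k Q i) = g (paIdem k Q i))
    (h2 : ∀ a, f (paArrow k Q a) = g (paArrow k Q a)) : f = g := by
  refine RingQuot.ringQuot_ext' k f g ?_
  refine FreeAlgebra.hom_ext ?_
  funext x
  rcases x with i | a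
  · exact h1 i
  · exact h2 a

variable (G : BrauerGraph) (D : Set G.quiver.A)

open Classical in
def cutArrow (a : G.quiver.A) : PathAlg k (cutQuiver G D) :=
  if h : a ∈ D then 0 else paArrow k (cutQuiver G D) ⟨a, h⟩

lemma cutArrow_mem {a : G.quiver.A} (h : a ∈ D) : cutArrow k G D a = 0 := dif_pos h

lemma cutArrow_not_mem {a : G.quiver.A} (h : a ∉ D) :
    cutArrow k G D a = paArrow k (cutQuiver G D) ⟨a, h⟩ := dif_neg h

def cutRetr : PathAlg k G.quiver →ₐ[k] PathAlg k (cutQuiver G D) :=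
  RingQuot.liftAlgHom k
    ⟨FreeAlgebra.lift k
        (Sum.elim (fun i => paIdem k (cutQuiver G D) i) (fun a => cutArrow k G D a)),
      by
        rintro x y ⟨rfl, hx⟩
        rw [map_zero]
        rcases hx with ⟨i, j, hij, rfl⟩ | ⟨i, rfl⟩ | rfl | ⟨a, rfl⟩ | ⟨a, rfl⟩
        · simp only [map_mul, FreeAlgebra.lift_ι_apply, Sum.elim_inl]
          exact paIdem_mul_paIdem_ne k (cutQuiver G D) hij
        · simp only [map_sub, map_mul, FreeAlgebra.lift_ι_apply, Sum.elim_inl]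
          exact sub_eq_zero.mpr (paIdem_mul_self k (cutQuiver G D) i)
        · simp only [map_sub, map_sum, map_one, FreeAlgebra.lift_ι_apply, Sum.elim_inl]
          exact sub_eq_zero.mpr (paIdem_sum k (cutQuiver G D))
        · simp only [map_sub, map_mul, FreeAlgebra.lift_ι_apply, Sum.elim_inl, Sum.elim_inr]
          by_cases h : a ∈ D
          · rw [cutArrow_mem k G D h, mul_zero, sub_zero]
          · rw [cutArrow_not_mem k G D h]
            exact sub_eq_zero.mpr (paIdem_src_mul k (cutQuiver G D) ⟨a, h⟩)
        · simp only [map_sub, map_mul, FreeAlgebra.lift_ι_apply, Sum.elim_inl, Sum.elim_inr]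
          by_cases h : a ∈ D
          · rw [cutArrow_mem k G D h, zero_mul, sub_zero]
          · rw [cutArrow_not_mem k G D h]
            exact sub_eq_zero.mpr (paArrow_mul_tgt k (cutQuiver G D) ⟨a, h⟩)⟩

lemma cutRetr_idem (i : G.quiver.V) :
    cutRetr k G D (paIdem k G.quiver i) = paIdem k (cutQuiver G D) i := by
  refine (RingQuot.liftAlgHom_mkAlgHom_apply k _ _ _).trans ?_
  simp

lemma cutRetr_arrow (a : G.quiver.A) :
    cutRetr k G D (paArrow k G.quiver a) = cutArrow k G D a := by
  refine (RingQuot.liftAlgHom_mkAlgHom_apply k _ _ _).trans ?_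
  simp

lemma cutEmbed_idem (i : G.quiver.V) :
    cutEmbed k G D (paIdem k (cutQuiver G D) i) = paIdem k G.quiver i := by
  refine (RingQuot.liftAlgHom_mkAlgHom_apply k _ _ _).trans ?_
  exact FreeAlgebra.lift_ι_apply _ _

lemma cutEmbed_arrow (a : (cutQuiver G D).A) :
    cutEmbed k G D (paArrow k (cutQuiver G D) a) = paArrow k G.quiver a.1 := by
  refine (RingQuot.liftAlgHom_mkAlgHom_apply k _ _ _).trans ?_
  simp

lemma cutRetr_embed (x : PathAlg k (cutQuiver G D)) :
    cutRetr k G D (cutEmbed k G D x) = x := by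
  have : (cutRetr k G D).comp (cutEmbed k G D) = AlgHom.id k _ := by
    refine pa_ext k _ (fun i => ?_) (fun a => ?_)
    · exact (congrArg (cutRetr k G D) (cutEmbed_idem k G D i)).trans (cutRetr_idem k G D i)
    · exact (congrArg (cutRetr k G D) (cutEmbed_arrow k G D a)).trans
        ((cutRetr_arrow k G D a.1).trans (cutArrow_not_mem k G D a.2))
  exact DFunLike.congr_fun this x

/-- The length two relations of the cut. -/
def cutRels : Set (PathAlg k (cutQuiver G D)) :=
  {x | ∃ a b : (cutQuiver G D).A, (cutQuiver G D).tgt a = (cutQuiver G D).src b ∧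
    ¬ G.σ.SameCycle a.1.1 b.1.1 ∧
    x = paArrow k (cutQuiver G D) a * paArrow k (cutQuiver G D) b}

lemma cutRetr_cycle (hD : IsCuttingSet G D) (h : G.H) (hh : G.hasArrow h) :
    cutRetr k G D (cycleEl k G h hh) = 0 := by
  obtain ⟨b, ⟨hb, hs⟩, -⟩ := hD ⟨h, hh⟩
  unfold cycleEl paPath
  rw [map_list_prod]
  refine List.prod_eq_zero ?_
  rw [List.mem_map]
  refine ⟨paArrow k G.quiver b, ?_, ?_⟩
  · refine List.mem_map_of_mem ?_
    refine List.mem_map.2 ?_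
    obtain ⟨n, hn⟩ := hs.exists_nat_pow_eq
    have hp : h ∈ Function.periodicPts (⇑G.σ) :=
      Function.Injective.mem_periodicPts G.σ.injective h
    refine ⟨n % Function.minimalPeriod (⇑G.σ) h, ?_, ?_⟩
    · rw [List.mem_range]
      exact Nat.mod_lt _ (Function.minimalPeriod_pos_of_mem_periodicPts hp)
    · apply Subtype.ext
      show (⇑G.σ)^[n % Function.minimalPeriod (⇑G.σ) h] h = b.1
      rw [Function.iterate_mod_minimalPeriod_eq, ← hn]
      rw [← Equiv.Perm.coe_pow]
  · rw [cutRetr_arrow, cutArrow_mem k G D hb]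

lemma cutRetr_rels (hD : IsCuttingSet G D) (x : PathAlg k G.quiver) (hx : x ∈ brauerRels k G) :
    bq k (cutQuiver G D) (cutRels k G D) (cutRetr k G D x) = 0 := by
  rcases hx with (⟨h, hh, hh', rfl⟩ | ⟨h, hh, -, rfl⟩) | ⟨a, b, hab, hs, rfl⟩
  · rw [map_sub, map_pow, map_pow, cutRetr_cycle k G D hD, cutRetr_cycle k G D hD,
      zero_pow (G.mult_pos _).ne', zero_pow (G.mult_pos _).ne', sub_zero, map_zero]
  · rw [map_mul, map_pow, cutRetr_cycle k G D hD, zero_pow (G.mult_pos _).ne', zero_mul, map_zero]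
  · rw [map_mul, cutRetr_arrow, cutRetr_arrow]
    by_cases ha : a ∈ D
    · rw [cutArrow_mem k G D ha, zero_mul, map_zero]
    by_cases hb : b ∈ D
    · rw [cutArrow_mem k G D hb, mul_zero, map_zero]
    rw [cutArrow_not_mem k G D ha, cutArrow_not_mem k G D hb]
    exact bq_mem k _ _ ⟨⟨a, ha⟩, ⟨b, hb⟩, hab, hs, rfl⟩

lemma mem_cutIdeal_iff (hD : IsCuttingSet G D) (x : PathAlg k (cutQuiver G D)) :
    x ∈ cutIdeal k G D ↔ bq k (cutQuiver G D) (cutRels k G D) x = 0 := by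
  constructor
  · intro hx
    have := bq_zero_imp k G.quiver (brauerRels k G)
      ((bq k (cutQuiver G D) (cutRels k G D)).comp (cutRetr k G D))
      (cutRetr_rels k G D hD) hx
    rwa [AlgHom.comp_apply, cutRetr_embed] at this
  · intro hx
    refine bq_zero_imp k (cutQuiver G D) (cutRels k G D)
      ((bq k G.quiver (brauerRels k G)).comp (cutEmbed k G D)) ?_ hx
    rintro _ ⟨a, b, hab, hs, rfl⟩
    rw [AlgHom.comp_apply, map_mul, cutEmbed_arrow, cutEmbed_arrow]
    exact bq_mem k _ _ (Or.inr ⟨a.1, b.1, hab, hs, rfl⟩)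

lemma bq_cutIdeal_iff (x : PathAlg k (cutQuiver G D)) :
    bq k (cutQuiver G D) (cutIdeal k G D) x = 0 ↔ x ∈ cutIdeal k G D :=
  ⟨fun hx => bq_zero_imp k (cutQuiver G D) (cutIdeal k G D)
      ((bq k G.quiver (brauerRels k G)).comp (cutEmbed k G D)) (fun _ hy => hy) hx,
    fun hx => bq_mem k _ _ hx⟩

lemma cut_equiv (hD : IsCuttingSet G D) :
    Nonempty (CutAlgebra k G D ≃ₐ[k] BQA k (cutQuiver G D) (cutIdeal k G D)) := by
  let ρ : Set (PathAlg k G.quiver) := brauerRels k G ∪ (paArrow k G.quiver '' D)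
  let I := cutIdeal k G D
  have hF : ∀ x ∈ ρ, ((bq k (cutQuiver G D) I).comp (cutRetr k G D)) x = 0 := by
    rintro x (hx | ⟨a, ha, rfl⟩)
    · exact bq_mem k _ _ ((mem_cutIdeal_iff k G D hD _).2 (cutRetr_rels k G D hD x hx))
    · rw [AlgHom.comp_apply, cutRetr_arrow, cutArrow_mem k G D ha, map_zero]
  have hE : ∀ x ∈ I, ((bq k G.quiver ρ).comp (cutEmbed k G D)) x = 0 := by
    intro x hx
    exact bq_zero_imp k G.quiver (brauerRels k G) (bq k G.quiver ρ)
      (fun y hy => bq_mem k _ _ (Or.inl hy)) hx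
  let F : BQA k G.quiver ρ →ₐ[k] BQA k (cutQuiver G D) I := bqLift k _ ρ _ hF
  let E : BQA k (cutQuiver G D) I →ₐ[k] BQA k G.quiver ρ := bqLift k _ I _ hE
  have hpa : (bq k G.quiver ρ).comp ((cutEmbed k G D).comp (cutRetr k G D)) =
      bq k G.quiver ρ := by
    refine pa_ext k _ (fun i => ?_) (fun a => ?_)
    · simp only [AlgHom.comp_apply]
      rw [cutRetr_idem, cutEmbed_idem]
    · simp only [AlgHom.comp_apply]
      rw [cutRetr_arrow]
      by_cases ha : a ∈ D
      · rw [cutArrow_mem k G D ha, map_zero, map_zero]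
        exact (bq_mem k _ _ (Or.inr ⟨a, ha, rfl⟩)).symm
      · rw [cutArrow_not_mem k G D ha]
        exact congrArg (bq k G.quiver ρ) (cutEmbed_arrow k G D ⟨a, ha⟩)
  have h1 : F.comp E = AlgHom.id k (BQA k (cutQuiver G D) I) := by
    refine bqa_ext k _ _ (fun x => ?_)
    show F (E (bq k (cutQuiver G D) I x)) = bq k (cutQuiver G D) I x
    simp only [F, E]
    rw [bqLift_bq, AlgHom.comp_apply, bqLift_bq, AlgHom.comp_apply, cutRetr_embed]
  have h2 : E.comp F = AlgHom.id k (BQA k G.quiver ρ) := by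
    refine bqa_ext k _ _ (fun x => ?_)
    show E (F (bq k G.quiver ρ x)) = bq k G.quiver ρ x
    simp only [F, E]
    rw [bqLift_bq, AlgHom.comp_apply, bqLift_bq]
    exact DFunLike.congr_fun hpa x
  have e : BQA k G.quiver ρ ≃ₐ[k] BQA k (cutQuiver G D) I := AlgEquiv.ofAlgHom F E h1 h2
  exact ⟨e⟩

end Helpers

/-- **Lemma (proof of Theorem 1.3).**  Let `Λ = kQ_Λ/I_Λ` be a Brauer graph algebra
over an algebraically closed field with multiplicity one at every vertex of its Brauer
graph, let `D` be a cutting set of `Q_Λ`, let `Q` be the quiver with the same vertices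
as `Q_Λ` and arrows `(Q_Λ)_1 \\ D`, and let `I = I_Λ ∩ kQ`.  Then the admissible cut
`kQ_Λ/J_Λ`, where `J_Λ` is the ideal generated by `I_Λ ∪ D`, is isomorphic to `kQ/I`,
and the ideal `I` is generated by paths of length two. -/
theorem stmt_13 (k : Type) [Field k] [IsAlgClosed k] (G : BrauerGraph)
    (hmult : ∀ h, G.mult h = 1) (D : Set G.quiver.A) (hD : IsCuttingSet G D) :
    Nonempty (CutAlgebra k G D ≃ₐ[k] BQA k (cutQuiver G D) (cutIdeal k G D)) ∧
    ∃ S : Set (PathAlg k (cutQuiver G D)),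
      (∀ x ∈ S, ∃ a b : (cutQuiver G D).A, (cutQuiver G D).tgt a = (cutQuiver G D).src b ∧
        x = paArrow k (cutQuiver G D) a * paArrow k (cutQuiver G D) b) ∧
      (∀ x : PathAlg k (cutQuiver G D),
        bq k (cutQuiver G D) (cutIdeal k G D) x = 0 ↔ bq k (cutQuiver G D) S x = 0) := by
  refine ⟨cut_equiv k G D hD, cutRels k G D, ?_, fun x => ?_⟩
  · rintro x ⟨a, b, hab, -, rfl⟩
    exact ⟨a, b, hab, rfl⟩
  · rw [bq_cutIdeal_iff, mem_cutIdeal_iff k G D hD]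
end
end
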